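/- arXiv:2601.13025 — 5 statements merged into one kernel-verified Lean document; each statement's English description precedes it below -/
import Mathlib

section
/- For any Majorana spinors χ, ψ of arbitrary parity and any α ∈ Λ²V acting in the spin and vector representations: χ̄ γ [α, ψ] = 3 (χ̄ γ ψ) α + (1/2) χ̄ [α, γ³]_V ψ, where γ := γ^a v_a, γ³ is its cube in C(V)⊗Λ•V, [α,ψ] := -(1/4)α^{ab}γ_{ab}ψ is the spin action, and [α, γ³]_V is the vector-representation action of α on the Λ³V factor of γ³. -/
noncomputable section

open scoped TensorProduct

/-- The Minkowski metric `η = diag(-1,1,1,1)` (self-inverse). -/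
def mink (a b : Fin 4) : ℂ := if a = b then (if a = 0 then -1 else 1) else 0

/-- `γ^a = η^{ab} γ_b`. -/
def gup (γ : Fin 4 → Matrix (Fin 4) (Fin 4) ℂ) (a : Fin 4) : Matrix (Fin 4) (Fin 4) ℂ :=
  ∑ b : Fin 4, mink a b • γ b

/-- `Λ•V` for `V = ℂ⁴` (the span of the `v_a`). -/
abbrev ExtV : Type := ExteriorAlgebra ℂ (Fin 4 → ℂ)

/-- The basis vector `v_a` inside `Λ•V`. -/
def vι (a : Fin 4) : ExtV := ExteriorAlgebra.ι ℂ (Pi.single a 1)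

/-- The spinor bilinear `χ̄ M ψ := ∑ (C M)_{αβ} χ_α ψ_β` with Grassmann-valued components. -/
def sbilin {A : Type*} [Ring A] [Algebra ℂ A]
    (C M : Matrix (Fin 4) (Fin 4) ℂ) (χ ψ : Fin 4 → A) : A :=
  ∑ i : Fin 4, ∑ j : Fin 4, (C * M) i j • (χ i * ψ j)

/-- The spin action `[α, ψ] := -(1/4) α^{ab} γ_{ab} ψ` of `α ∈ Λ²V` on a spinor `ψ`. -/
def spinAct {A : Type*} [Ring A] [Algebra ℂ A]
    (γ : Fin 4 → Matrix (Fin 4) (Fin 4) ℂ) (α : Fin 4 → Fin 4 → ℂ) (ψ : Fin 4 → A) :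
    Fin 4 → A := fun i =>
  ∑ j : Fin 4,
    ((∑ a : Fin 4, ∑ b : Fin 4,
      ((-(1 : ℂ) / 4) * α a b) • (((1 : ℂ) / 2) • (γ a * γ b - γ b * γ a))) i j) • ψ j

/-- The vector-representation action of `α ∈ Λ²V` on the basis vector `v_d`:
`[α, v_d]_V = α^{ab} η_{bd} v_a`. -/
def vecAct (α : Fin 4 → Fin 4 → ℂ) (d : Fin 4) : ExtV :=
  ∑ a : Fin 4, ∑ b : Fin 4, (α a b * mink b d) • vι a

set_option linter.unusedSimpArgs false

section core
variable {B : Type*} [Ring B] [Algebra ℂ B]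

/-- The cube of a sum of four commuting nilpotent elements. -/
lemma cube_four (x : Fin 4 → B) (hx : ∀ a b, x a * x b = x b * x a) (hxx : ∀ a, x a * x a = 0) :
    (x 0 + x 1 + x 2 + x 3) * (x 0 + x 1 + x 2 + x 3) * (x 0 + x 1 + x 2 + x 3)
      = (6 : ℂ) • (x 0 * x 1 * x 2 + x 0 * x 1 * x 3 + x 0 * x 2 * x 3 + x 1 * x 2 * x 3) := by
  have hxx' : ∀ a (z : B), x a * (x a * z) = 0 := fun a z => by rw [← mul_assoc, hxx, zero_mul]
  have hx' : ∀ a b (z : B), x a * (x b * z) = x b * (x a * z) := fun a b z => by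
    rw [← mul_assoc, hx, mul_assoc]
  simp only [mul_add, add_mul, mul_assoc, hxx, hxx', hx 1 0, hx 2 0, hx 3 0, hx 2 1, hx 3 1, hx 3 2,
    hx' 1 0, hx' 2 0, hx' 3 0, hx' 2 1, hx' 3 1, hx' 3 2, mul_zero, zero_mul]
  module

lemma core_comm (g v : Fin 4 → B) (G : B)
    (hG : ∀ a, G * g a = - (g a * G) - (2 : ℂ) • v a)
    (hgv : ∀ a b, v a * g b = g b * v a) (d e : Fin 4) :
    G * (g d * g e) - (g d * g e) * G = (2 : ℂ) • (g d * v e - g e * v d) := by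
  rw [← mul_assoc, hG, sub_mul, neg_mul, mul_assoc (g d) G, hG]
  simp only [mul_sub, mul_neg, smul_mul_assoc, mul_smul_comm, hgv, mul_assoc]
  module

lemma core_anti (g v : Fin 4 → B)
    (hg : ∀ a b, a ≠ b → g a * g b = - (g b * g a))
    (hg0 : g 0 * g 0 = 1) (hg1 : ∀ a, a ≠ 0 → g a * g a = -1)
    (hv : ∀ a b, v a * v b = - (v b * v a))
    (hvv : ∀ a, v a * v a = 0)
    (hgv : ∀ a b, v a * g b = g b * v a) (G : B)
    (hG : G = - (g 0 * v 0) + g 1 * v 1 + g 2 * v 2 + g 3 * v 3) (d e : Fin 4) (hde : d < e) :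
    G * G * G * (g d * g e) + (g d * g e) * (G * G * G) = (-12 : ℂ) • (G * (v d * v e)) := by
  have hgv' : ∀ a b (z : B), v a * (g b * z) = g b * (v a * z) := fun a b z => by
    rw [← mul_assoc, hgv, mul_assoc]
  have hg' : ∀ a b (z : B), a ≠ b → g a * (g b * z) = - (g b * (g a * z)) := fun a b z h => by
    rw [← mul_assoc, hg a b h, neg_mul, mul_assoc]
  have hv' : ∀ a b (z : B), v a * (v b * z) = - (v b * (v a * z)) := fun a b z => by
    rw [← mul_assoc, hv a b, neg_mul, mul_assoc]
  have hvv' : ∀ a (z : B), v a * (v a * z) = 0 := fun a z => by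
    rw [← mul_assoc, hvv, zero_mul]
  have hg0' : ∀ z : B, g 0 * (g 0 * z) = z := fun z => by rw [← mul_assoc, hg0, one_mul]
  have hg1' : ∀ a (z : B), a ≠ 0 → g a * (g a * z) = -z := fun a z h => by
    rw [← mul_assoc, hg1 a h, neg_one_mul]
  have h3 : G * G * G = (6 : ℂ) • (- (g 0 * g 1 * g 2 * (v 0 * v 1 * v 2))
      - g 0 * g 1 * g 3 * (v 0 * v 1 * v 3)
      - g 0 * g 2 * g 3 * (v 0 * v 2 * v 3)
      + g 1 * g 2 * g 3 * (v 1 * v 2 * v 3)) := by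
    have := cube_four (B := B) ![- (g 0 * v 0), g 1 * v 1, g 2 * v 2, g 3 * v 3] ?_ ?_
    · simp only [Matrix.cons_val] at this
      rw [hG, this]
      simp only [mul_assoc, hgv', neg_mul]
      module
    · intro a b
      fin_cases a <;> fin_cases b <;> simp only [Matrix.cons_val, Fin.mk_one, Fin.zero_eta,
        Fin.reduceFinMk, Fin.isValue, mul_neg, neg_mul, neg_neg, mul_assoc, hgv',
        hv 1 0, hv 2 0, hv 3 0, hv 2 1, hv 3 1, hv 3 2, hg' 1 0 _ (by decide), hg' 2 0 _ (by decide),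
        hg' 3 0 _ (by decide), hg' 2 1 _ (by decide), hg' 3 1 _ (by decide), hg' 3 2 _ (by decide)]
    · intro a
      fin_cases a <;> simp [mul_assoc, hgv', hvv]
  rw [h3, hG]
  clear h3 hG
  fin_cases d <;> fin_cases e <;> first
    | exact absurd hde (by decide)
    | (simp only [Fin.mk_one, Fin.zero_eta,
        Fin.reduceFinMk, Fin.isValue, mul_neg, neg_mul, neg_neg, mul_assoc, hgv', hgv,
        mul_add, add_mul, mul_sub, sub_mul, smul_mul_assoc, mul_smul_comm,
        hvv, hvv', hg0, hg0', hg1 1 (by decide), hg1 2 (by decide), hg1 3 (by decide),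
        hg1' 1 _ (by decide), hg1' 2 _ (by decide), hg1' 3 _ (by decide),
        hv 1 0, hv 2 0, hv 3 0, hv 2 1, hv 3 1, hv 3 2,
        hv' 1 0, hv' 2 0, hv' 3 0, hv' 2 1, hv' 3 1, hv' 3 2,
        hg' 1 0 _ (by decide), hg' 2 0 _ (by decide),
        hg' 3 0 _ (by decide), hg' 2 1 _ (by decide), hg' 3 1 _ (by decide), hg' 3 2 _ (by decide),
        mul_zero, zero_mul, neg_zero, mul_one, one_mul]
       module)

/-- The whole identity in an abstract algebra containing commuting copies of the Clifford
and exterior generators. -/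
lemma core_main (g v : Fin 4 → B)
    (hcl : ∀ a b, g a * g b + g b * g a = (-2 * mink a b) • (1 : B))
    (hv : ∀ a b, v a * v b = - (v b * v a))
    (hvv : ∀ a, v a * v a = 0)
    (hgv : ∀ a b, v a * g b = g b * v a)
    (α : Fin 4 → Fin 4 → ℂ) (hα : ∀ a b, α a b = - α b a) (G S H : B)
    (hG : G = ∑ a, (∑ b, mink a b • g b) * v a)
    (hS : S = ∑ a, ∑ b, ((-(1 : ℂ) / 4) * α a b) • (((1 : ℂ) / 2) • (g a * g b - g b * g a)))
    (hH : H = ∑ d, (∑ b, mink d b • g b) * (∑ a, ∑ b, (α a b * mink b d) • v a)) :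
    G * G * G * S = (3 : ℂ) • (G * ∑ b, ∑ c, ((1 : ℂ) / 2 * α b c) • (v b * v c))
      + ((1 : ℂ) / 2) • (H * G * G + G * H * G + G * G * H) := by
  have hg : ∀ a b, a ≠ b → g a * g b = - (g b * g a) := fun a b h => by
    have := hcl a b
    simp only [mink, if_neg h, mul_zero, zero_smul] at this
    exact eq_neg_of_add_eq_zero_left this
  have hsq : ∀ a, g a * g a = (- mink a a) • (1 : B) := fun a => by
    have h2 : (2 : ℂ) • (g a * g a) = (2 : ℂ) • ((- mink a a) • (1 : B)) := by
      rw [two_smul, hcl a a, smul_smul]; congr 1; ring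
    exact smul_right_injective B (two_ne_zero (α := ℂ)) h2
  have hg0 : g 0 * g 0 = 1 := by rw [hsq]; simp [mink]
  have hg1 : ∀ a, a ≠ 0 → g a * g a = -1 := fun a h => by rw [hsq]; simp [mink, h]
  have hG' : G = - (g 0 * v 0) + g 1 * v 1 + g 2 * v 2 + g 3 * v 3 := by
    rw [hG]; simp [Fin.sum_univ_four, mink]
  have hGg : ∀ a, G * g a = - (g a * G) - (2 : ℂ) • v a := by
    intro a
    have : G * g a + g a * G = - ((2 : ℂ) • v a) := by
      have e : G * g a + g a * G = ∑ b, (∑ c, mink b c • (g c * g a + g a * g c)) * v b := by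
        rw [hG]
        simp only [Finset.sum_mul, Finset.mul_sum, ← Finset.sum_add_distrib, smul_mul_assoc,
          mul_smul_comm, smul_add, add_mul, mul_assoc, hgv]
      rw [e]
      simp only [hcl]
      fin_cases a <;> simp [Fin.sum_univ_four, mink]
    rw [← sub_eq_zero] at this ⊢
    rw [← this]; abel
  have hd : ∀ a, α a a = 0 := fun a => by
    have := hα a a
    linear_combination (1/2 : ℂ) * this
  have hS' : S = ∑ a, ∑ b, ((-(1 : ℂ) / 4) * α a b) • (g a * g b) := by
    rw [hS]
    refine Finset.sum_congr rfl fun a _ => Finset.sum_congr rfl fun b _ => ?_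
    by_cases h : a = b
    · subst h; simp [hd]
    · rw [hg b a (Ne.symm h)]; module
  have hS6 : S = (-(1 : ℂ) / 2) • (α 0 1 • (g 0 * g 1) + α 0 2 • (g 0 * g 2) + α 0 3 • (g 0 * g 3)
      + α 1 2 • (g 1 * g 2) + α 1 3 • (g 1 * g 3) + α 2 3 • (g 2 * g 3)) := by
    rw [hS']
    simp only [Fin.sum_univ_four, hd, hα 1 0, hα 2 0, hα 3 0, hα 2 1, hα 3 1, hα 3 2,
      hg 1 0 (by decide), hg 2 0 (by decide), hg 3 0 (by decide), hg 2 1 (by decide),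
      hg 3 1 (by decide), hg 3 2 (by decide)]
    module
  have hcomm : G * S - S * G = H := by
    have e : G * S - S * G =
        ∑ a, ∑ b, ((-(1 : ℂ) / 4) * α a b) • (G * (g a * g b) - (g a * g b) * G) := by
      rw [hS']
      simp only [Finset.sum_mul, Finset.mul_sum, ← Finset.sum_sub_distrib, smul_mul_assoc,
          mul_smul_comm, smul_sub]
    rw [e, hH]
    simp only [core_comm g v G hGg hgv]
    simp [Fin.sum_univ_four, mink, hd, hα 1 0, hα 2 0, hα 3 0, hα 2 1, hα 3 1, hα 3 2, mul_add]
    module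
  have hanti : G * G * G * S + S * (G * G * G) =
      (6 : ℂ) • (G * ∑ b, ∑ c, ((1 : ℂ) / 2 * α b c) • (v b * v c)) := by
    have key := core_anti g v hg hg0 hg1 hv hvv hgv G hG'
    have k01 := key 0 1 (by decide)
    have k02 := key 0 2 (by decide)
    have k03 := key 0 3 (by decide)
    have k12 := key 1 2 (by decide)
    have k13 := key 1 3 (by decide)
    have k23 := key 2 3 (by decide)
    have e : (∑ b, ∑ c, ((1 : ℂ) / 2 * α b c) • (v b * v c)) =
      α 0 1 • (v 0 * v 1) + α 0 2 • (v 0 * v 2) + α 0 3 • (v 0 * v 3)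
      + α 1 2 • (v 1 * v 2) + α 1 3 • (v 1 * v 3) + α 2 3 • (v 2 * v 3) := by
      simp only [Fin.sum_univ_four, hd, hα 1 0, hα 2 0, hα 3 0, hα 2 1, hα 3 1, hα 3 2,
        hv 1 0, hv 2 0, hv 3 0, hv 2 1, hv 3 1, hv 3 2]
      module
    rw [e, hS6]
    generalize G * G * G = K at *
    simp only [mul_add, add_mul, smul_mul_assoc, mul_smul_comm, smul_add]
    linear_combination (norm := module) (-(1 : ℂ) / 2 * α 0 1) • k01 + (-(1 : ℂ) / 2 * α 0 2) • k02
      + (-(1 : ℂ) / 2 * α 0 3) • k03 + (-(1 : ℂ) / 2 * α 1 2) • k12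
      + (-(1 : ℂ) / 2 * α 1 3) • k13 + (-(1 : ℂ) / 2 * α 2 3) • k23
  have hH3 : H * G * G + G * H * G + G * G * H = G * G * G * S - S * (G * G * G) := by
    rw [← hcomm]; noncomm_ring
  rw [hH3]
  have := congrArg (fun z => ((1 : ℂ) / 2) • z) hanti
  simp only [smul_add, smul_smul] at this
  have e2 : (3 : ℂ) • (G * ∑ b, ∑ c, ((1 : ℂ) / 2 * α b c) • (v b * v c)) =
    ((1 : ℂ) / 2) • (G * G * G * S) + ((1 : ℂ) / 2) • (S * (G * G * G)) := by
    rw [this]; congr 1; norm_num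
  rw [e2]
  module
end core

lemma triple_sum {B : Type*} [Ring B] (x y z : Fin 4 → B) :
    (∑ a, x a) * (∑ a, y a) * (∑ a, z a) = ∑ a, ∑ b, ∑ c, x a * y b * z c := by
  rw [Finset.sum_mul_sum, Finset.sum_mul]
  refine Finset.sum_congr rfl fun a _ => ?_
  rw [Finset.sum_mul_sum]

/-- `sbilin` as a linear map in the matrix. -/
def sbilinLin {A : Type*} [Ring A] [Algebra ℂ A]
    (C : Matrix (Fin 4) (Fin 4) ℂ) (χ ψ : Fin 4 → A) : Matrix (Fin 4) (Fin 4) ℂ →ₗ[ℂ] A where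
  toFun M := sbilin C M χ ψ
  map_add' M N := by
    simp only [sbilin, mul_add, Matrix.add_apply, add_smul, Finset.sum_add_distrib]
  map_smul' c M := by
    simp only [sbilin, Matrix.mul_smul, Matrix.smul_apply, smul_eq_mul, mul_smul,
      Finset.smul_sum, RingHom.id_apply]

lemma sbilinLin_apply {A : Type*} [Ring A] [Algebra ℂ A]
    (C M : Matrix (Fin 4) (Fin 4) ℂ) (χ ψ : Fin 4 → A) :
    sbilinLin C χ ψ M = sbilin C M χ ψ := rfl

lemma sbilin_spinAct {A : Type*} [Ring A] [Algebra ℂ A]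
    (γ : Fin 4 → Matrix (Fin 4) (Fin 4) ℂ) (α : Fin 4 → Fin 4 → ℂ)
    (C M : Matrix (Fin 4) (Fin 4) ℂ) (χ ψ : Fin 4 → A) :
    sbilin C M χ (spinAct γ α ψ) = sbilin C (M * ∑ a : Fin 4, ∑ b : Fin 4,
      ((-(1 : ℂ) / 4) * α a b) • (((1 : ℂ) / 2) • (γ a * γ b - γ b * γ a))) χ ψ := by
  unfold sbilin spinAct
  generalize (∑ a : Fin 4, ∑ b : Fin 4,
      ((-(1 : ℂ) / 4) * α a b) • (((1 : ℂ) / 2) • (γ a * γ b - γ b * γ a))) = S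
  rw [← mul_assoc]
  generalize C * M = N
  refine Finset.sum_congr rfl fun i _ => ?_
  simp only [Matrix.mul_apply, Finset.sum_smul, Finset.mul_sum, Finset.smul_sum, mul_smul_comm,
    smul_smul]
  rw [Finset.sum_comm]

/-- The identity in `C(V) ⊗ Λ•V`. -/
lemma tensor_identity (γ : Fin 4 → Matrix (Fin 4) (Fin 4) ℂ)
    (hcl : ∀ a b : Fin 4,
      γ a * γ b + γ b * γ a = (-2 * mink a b) • (1 : Matrix (Fin 4) (Fin 4) ℂ))
    (α : Fin 4 → Fin 4 → ℂ) (hα : ∀ a b, α a b = - α b a)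
    (Sm : Matrix (Fin 4) (Fin 4) ℂ) (hSm : Sm = ∑ a : Fin 4, ∑ b : Fin 4,
      ((-(1 : ℂ) / 4) * α a b) • (((1 : ℂ) / 2) • (γ a * γ b - γ b * γ a))) :
    (∑ a : Fin 4, ∑ b : Fin 4, ∑ c : Fin 4,
      (gup γ a * gup γ b * gup γ c * Sm) ⊗ₜ[ℂ] (vι a * vι b * vι c)) =
    (∑ a : Fin 4, ∑ b : Fin 4, ∑ c : Fin 4,
        ((3 : ℂ) * (((1 : ℂ) / 2) * α b c)) • (gup γ a ⊗ₜ[ℂ] (vι a * vι b * vι c)))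
    + ((1 : ℂ) / 2) •
        ∑ a : Fin 4, ∑ b : Fin 4, ∑ c : Fin 4,
          (gup γ a * gup γ b * gup γ c)
            ⊗ₜ[ℂ] (vecAct α a * vι b * vι c + vι a * vecAct α b * vι c
              + vι a * vι b * vecAct α c) := by
  obtain ⟨g, hg⟩ : ∃ g : Fin 4 → Matrix (Fin 4) (Fin 4) ℂ ⊗[ℂ] ExtV,
    ∀ a, g a = γ a ⊗ₜ 1 := ⟨_, fun _ => rfl⟩
  obtain ⟨v, hv⟩ : ∃ v : Fin 4 → Matrix (Fin 4) (Fin 4) ℂ ⊗[ℂ] ExtV,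
    ∀ a, v a = 1 ⊗ₜ vι a := ⟨_, fun _ => rfl⟩
  have h1 : ∀ a b, g a * g b + g b * g a =
      (-2 * mink a b) • (1 : Matrix (Fin 4) (Fin 4) ℂ ⊗[ℂ] ExtV) := by
    intro a b
    simp only [hg, Algebra.TensorProduct.tmul_mul_tmul, mul_one, ← TensorProduct.add_tmul, hcl,
      ← TensorProduct.smul_tmul', Algebra.TensorProduct.one_def]
  have h2 : ∀ a b, v a * v b = - (v b * v a) := by
    intro a b
    have : vι a * vι b = - (vι b * vι a) :=
      eq_neg_of_add_eq_zero_left (ExteriorAlgebra.ι_add_mul_swap _ _)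
    rw [hv, hv, Algebra.TensorProduct.tmul_mul_tmul, Algebra.TensorProduct.tmul_mul_tmul, this,
      TensorProduct.tmul_neg]
  have h3 : ∀ a, v a * v a = 0 := by
    intro a
    have : vι a * vι a = 0 := ExteriorAlgebra.ι_sq_zero _
    rw [hv, Algebra.TensorProduct.tmul_mul_tmul, this, TensorProduct.tmul_zero]
  have h4 : ∀ a b, v a * g b = g b * v a := by
    intro a b
    simp only [hv, hg, Algebra.TensorProduct.tmul_mul_tmul, mul_one, one_mul]
  have hgup : ∀ a, (∑ b, mink a b • g b) = gup γ a ⊗ₜ 1 := fun a => by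
    simp only [gup, TensorProduct.sum_tmul, TensorProduct.smul_tmul', hg]
  have hvec : ∀ d, (∑ a, ∑ b, (α a b * mink b d) • v a) = 1 ⊗ₜ vecAct α d := fun d => by
    simp only [vecAct, TensorProduct.tmul_sum, TensorProduct.tmul_smul, hv]
  have hS : Sm ⊗ₜ[ℂ] (1 : ExtV) =
      ∑ a, ∑ b, ((-(1 : ℂ) / 4) * α a b) • (((1 : ℂ) / 2) • (g a * g b - g b * g a)) := by
    simp only [hSm, TensorProduct.sum_tmul, ← TensorProduct.smul_tmul', hg,
      Algebra.TensorProduct.tmul_mul_tmul, mul_one, TensorProduct.sub_tmul]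
  have main := core_main g v h1 h2 h3 h4 α hα (∑ a, gup γ a ⊗ₜ[ℂ] vι a) (Sm ⊗ₜ[ℂ] 1)
    (∑ a, gup γ a ⊗ₜ[ℂ] vecAct α a) ?_ hS ?_
  · rw [triple_sum, triple_sum, triple_sum, triple_sum] at main
    simp only [hv, Finset.sum_mul, Finset.mul_sum, Finset.smul_sum,
      Algebra.TensorProduct.tmul_mul_tmul, mul_one, mul_smul_comm, smul_smul] at main
    rw [main]
    refine congrArg₂ (· + ·) ?_ ?_
    · simp only [mul_assoc]
      symm
      rw [Finset.sum_comm]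
      exact Finset.sum_congr rfl fun x _ => Finset.sum_comm
    · simp only [TensorProduct.tmul_add, Finset.sum_add_distrib]
  · simp only [hgup, hv, Algebra.TensorProduct.tmul_mul_tmul, mul_one, one_mul]
  · simp only [hgup, hvec, Algebra.TensorProduct.tmul_mul_tmul, mul_one, one_mul]

/-- For any Majorana spinors `χ, ψ` of arbitrary parity and any
`α ∈ Λ²V` (with antisymmetric coefficients `α^{ab}`) acting in the spin and vector
representations:
`χ̄ γ³ [α, ψ] = 3 (χ̄ γ ψ) ∧ α + (1/2) χ̄ [α, γ³]_V ψ`,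
where `γ := γ^a v_a`, `γ³` is its cube in `C(V) ⊗ Λ•V`, `[α,ψ] = -(1/4)α^{ab}γ_{ab}ψ`
is the spin action, and `[α, γ³]_V` is the vector-representation action of `α` on the
`Λ³V` factor of `γ³` (acting as a derivation).  All terms are `Λ³V`-valued with
Grassmann coefficients, i.e. elements of `A ⊗ Λ•V`. -/
theorem gamma_cubed_spin_action_identity {A : Type*} [Ring A] [Algebra ℂ A]
    (γ : Fin 4 → Matrix (Fin 4) (Fin 4) ℂ)
    (hcl : ∀ a b : Fin 4,
      γ a * γ b + γ b * γ a = (-2 * mink a b) • (1 : Matrix (Fin 4) (Fin 4) ℂ))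
    (C : Matrix (Fin 4) (Fin 4) ℂ)
    (hC : C.transpose = -C)
    (hCγ : ∀ a : Fin 4, (C * γ a).transpose = C * γ a)
    (χ ψ : Fin 4 → A) (p q : ℕ)
    (hKoszul : ∀ i j : Fin 4, χ i * ψ j = ((-1 : ℂ) ^ (p * q)) • (ψ j * χ i))
    (α : Fin 4 → Fin 4 → ℂ) (hα : ∀ a b, α a b = - α b a) :
    -- χ̄ γ³ [α, ψ]
    (∑ a : Fin 4, ∑ b : Fin 4, ∑ c : Fin 4,
        (sbilin C (gup γ a * gup γ b * gup γ c) χ (spinAct γ α ψ))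
          ⊗ₜ[ℂ] (vι a * vι b * vι c) : A ⊗[ℂ] ExtV)
    -- 3 (χ̄ γ ψ) ∧ α, with α = (1/2) α^{bc} v_b ∧ v_c
    = (∑ a : Fin 4, ∑ b : Fin 4, ∑ c : Fin 4,
        ((3 : ℂ) * (((1 : ℂ) / 2) * α b c)) •
          ((sbilin C (gup γ a) χ ψ) ⊗ₜ[ℂ] (vι a * vι b * vι c)))
    -- + (1/2) χ̄ [α, γ³]_V ψ
    + ((1 : ℂ) / 2) •
        ∑ a : Fin 4, ∑ b : Fin 4, ∑ c : Fin 4,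
          (sbilin C (gup γ a * gup γ b * gup γ c) χ ψ)
            ⊗ₜ[ℂ] (vecAct α a * vι b * vι c + vι a * vecAct α b * vι c
              + vι a * vι b * vecAct α c) := by
  have key := congrArg (TensorProduct.map (sbilinLin C χ ψ) (LinearMap.id (R := ℂ) (M := ExtV)))
    (tensor_identity γ hcl α hα _ rfl)
  simp only [map_add, map_sum, map_smul, TensorProduct.map_tmul, sbilinLin_apply,
    LinearMap.id_apply] at key
  simp only [sbilin_spinAct]
  exact key
end
end

section
/- (Splitting of (2,1)-forms) Let V be 4-dimensional, e: R³→V injective, and ε_n ∈ V such that (e(∂_1), e(∂_2), e(∂_3), ε_n) is a basis of V. For α ∈ Λ²(R³)*⊗V: α = 0 if and only if e∧α = 0 in Λ³(R³)*⊗Λ²V and ε_n∧α lies in the image of the map W_1^{∂(1,1)}: Λ¹(R³)*⊗V → Λ²(R³)*⊗Λ²V, β ↦ e∧β. -/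
noncomputable section

/-- The (pointwise) total exterior algebra `Λ•((ℝ³)* ⊕ V)`, inside which all the spaces
`Ω_∂^{(k,l)} = Λ^k(ℝ³)* ⊗ Λ^l V` are realised (the boundary cotangent factor being
modelled by the 3-dimensional space `ℝ³`). -/
abbrev BExt (V : Type*) [AddCommGroup V] [Module ℝ V] : Type _ :=
  ExteriorAlgebra ℝ ((Fin 3 → ℝ) × V)

/-- The inclusion of a boundary covector into `BExt V`. -/
def ιW (V : Type*) [AddCommGroup V] [Module ℝ V] (w : Fin 3 → ℝ) : BExt V :=
  ExteriorAlgebra.ι ℝ (w, 0)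

/-- The inclusion of a vector of `V` into `BExt V`. -/
def ιV {V : Type*} [AddCommGroup V] [Module ℝ V] (v : V) : BExt V :=
  ExteriorAlgebra.ι ℝ ((0 : Fin 3 → ℝ), v)

/-- The subspace `Ω_∂^{(k,l)} = Λ^k(ℝ³)* ⊗ Λ^l V` of `BExt V`. -/
def Omeg (V : Type*) [AddCommGroup V] [Module ℝ V] (k l : ℕ) : Submodule ℝ (BExt V) :=
  (LinearMap.range ((ExteriorAlgebra.ι ℝ).comp (LinearMap.inl ℝ (Fin 3 → ℝ) V))) ^ k *
    (LinearMap.range ((ExteriorAlgebra.ι ℝ).comp (LinearMap.inr ℝ (Fin 3 → ℝ) V))) ^ l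

/-- The boundary coframe `e ∈ Ω_∂^{(1,1)}` associated to an injective linear map
`e : ℝ³ → V`. -/
def Eelt {V : Type*} [AddCommGroup V] [Module ℝ V] (e : (Fin 3 → ℝ) →ₗ[ℝ] V) : BExt V :=
  ∑ i : Fin 3, ιW V (Pi.single i 1) * ιV (e (Pi.single i 1))

set_option linter.unusedSimpArgs false
set_option linter.unusedSectionVars false

section helpers
variable {A : Type*} [Ring A] [Algebra ℝ A]

lemma swap_lt (g : Fin 7 → A) (hanti : ∀ i j, g i * g j = -(g j * g i)) (i j : Fin 7)
    : g j * g i = -(g i * g j) := hanti j i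

lemma swap_lt_assoc (g : Fin 7 → A) (hanti : ∀ i j, g i * g j = -(g j * g i)) (i j : Fin 7)
    (z : A) : g j * (g i * z) = -(g i * (g j * z)) := by
  rw [← mul_assoc, hanti j i, neg_mul, mul_assoc]

lemma sq_assoc (g : Fin 7 → A) (hsq : ∀ i, g i * g i = 0) (i : Fin 7) (z : A) :
    g i * (g i * z) = 0 := by
  rw [← mul_assoc, hsq, zero_mul]

/-- The form of type (2,1) with coefficients `a`. -/
def alphaForm (g : Fin 7 → A) (a : Fin 3 → Fin 4 → ℝ) : A :=
  ∑ k : Fin 4, (a 0 k • (g 1 * (g 2 * g (Fin.natAdd 3 k))) +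
    a 1 k • (g 2 * (g 0 * g (Fin.natAdd 3 k))) + a 2 k • (g 0 * (g 1 * g (Fin.natAdd 3 k))))

/-- The form of type (1,1) with coefficients `b`. -/
def betaForm (g : Fin 7 → A) (b : Fin 3 → Fin 4 → ℝ) : A :=
  ∑ k : Fin 4, (b 0 k • (g 0 * g (Fin.natAdd 3 k)) +
    b 1 k • (g 1 * g (Fin.natAdd 3 k)) + b 2 k • (g 2 * g (Fin.natAdd 3 k)))

lemma extract1 (g : Fin 7 → A) (hsq : ∀ i, g i * g i = 0)
    (hanti : ∀ i j, g i * g j = -(g j * g i))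
    (htop : g 0 * (g 1 * (g 2 * (g 3 * (g 4 * (g 5 * g 6))))) ≠ 0)
    (a : Fin 3 → Fin 4 → ℝ)
    (h1 : (g 0 * g 3 + g 1 * g 4 + g 2 * g 5) * alphaForm g a = 0) :
    a 0 3 = 0 ∧ a 1 3 = 0 ∧ a 2 3 = 0 ∧ a 0 1 = a 1 0 ∧ a 0 2 = a 2 0 ∧ a 1 2 = a 2 1 := by
  have key : ∀ p q, (g 0 * g 3 + g 1 * g 4 + g 2 * g 5) * alphaForm g a * (g p * g q) = 0 := by
    intro p q; rw [h1, zero_mul]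
  have s := swap_lt g hanti
  have sa := swap_lt_assoc g hanti
  have za := sq_assoc g hsq
  have e0 : (Fin.natAdd 3 (0 : Fin 4) : Fin 7) = 3 := rfl
  have e1 : (Fin.natAdd 3 (1 : Fin 4) : Fin 7) = 4 := rfl
  have e2 : (Fin.natAdd 3 (2 : Fin 4) : Fin 7) = 5 := rfl
  have e3 : (Fin.natAdd 3 (3 : Fin 4) : Fin 7) = 6 := rfl
  simp only [alphaForm, Fin.sum_univ_four, e0, e1, e2, e3, add_mul, mul_add, smul_mul_assoc,
    mul_smul_comm, mul_assoc] at key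
  have k1 := key 3 4
  have k2 := key 3 5
  have k3 := key 4 5
  have k4 := key 3 6
  have k5 := key 4 6
  have k6 := key 5 6
  clear key
  simp only [s 0 1, s 0 2, s 0 3, s 0 4, s 0 5, s 0 6, s 1 2, s 1 3, s 1 4,
    s 1 5, s 1 6, s 2 3, s 2 4, s 2 5, s 2 6, s 3 4, s 3 5, s 3 6, s 4 5, s 4 6, s 5 6,
    sa 0 1, sa 0 2, sa 0 3, sa 0 4, sa 0 5, sa 0 6, sa 1 2, sa 1 3, sa 1 4,
    sa 1 5, sa 1 6, sa 2 3, sa 2 4, sa 2 5, sa 2 6, sa 3 4, sa 3 5, sa 3 6, sa 4 5, sa 4 6,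
    sa 5 6, hsq, za, mul_neg, neg_neg, neg_zero, mul_zero, smul_zero, add_zero, zero_add,
    smul_neg, ← neg_smul, ← add_smul, smul_eq_zero, htop, or_false] at k1 k2 k3 k4 k5 k6
  refine ⟨?_, ?_, ?_, ?_, ?_, ?_⟩ <;> linarith

lemma extract2 (g : Fin 7 → A) (hsq : ∀ i, g i * g i = 0)
    (hanti : ∀ i j, g i * g j = -(g j * g i))
    (htop : g 0 * (g 1 * (g 2 * (g 3 * (g 4 * (g 5 * g 6))))) ≠ 0)
    (a b : Fin 3 → Fin 4 → ℝ)
    (h1 : g 6 * alphaForm g a = (g 0 * g 3 + g 1 * g 4 + g 2 * g 5) * betaForm g b) :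
    a 0 0 = 0 ∧ a 1 1 = 0 ∧ a 2 2 = 0 ∧ a 0 1 = - a 1 0 ∧ a 0 2 = - a 2 0 ∧ a 1 2 = - a 2 1 := by
  have key : ∀ m p q, g m * (g 6 * alphaForm g a) * (g p * g q) +
      (-1 : ℝ) • (g m * ((g 0 * g 3 + g 1 * g 4 + g 2 * g 5) * betaForm g b) * (g p * g q))
        = 0 := by
    intro m p q; rw [h1, neg_one_smul, add_neg_cancel]
  have s := swap_lt g hanti
  have sa := swap_lt_assoc g hanti
  have za := sq_assoc g hsq
  have e0 : (Fin.natAdd 3 (0 : Fin 4) : Fin 7) = 3 := rfl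
  have e1 : (Fin.natAdd 3 (1 : Fin 4) : Fin 7) = 4 := rfl
  have e2 : (Fin.natAdd 3 (2 : Fin 4) : Fin 7) = 5 := rfl
  have e3 : (Fin.natAdd 3 (3 : Fin 4) : Fin 7) = 6 := rfl
  simp only [alphaForm, betaForm, Fin.sum_univ_four, e0, e1, e2, e3, add_mul, mul_add,
    smul_mul_assoc, mul_smul_comm, mul_assoc, smul_add, smul_smul] at key
  have k1 := key 0 3 4
  have k2 := key 0 3 5
  have k3 := key 0 4 5
  have k4 := key 1 3 4
  have k5 := key 1 3 5
  have k6 := key 1 4 5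
  have k7 := key 2 3 4
  have k8 := key 2 3 5
  have k9 := key 2 4 5
  clear key
  simp only [s 0 1, s 0 2, s 0 3, s 0 4, s 0 5, s 0 6, s 1 2, s 1 3, s 1 4,
    s 1 5, s 1 6, s 2 3, s 2 4, s 2 5, s 2 6, s 3 4, s 3 5, s 3 6, s 4 5, s 4 6, s 5 6,
    sa 0 1, sa 0 2, sa 0 3, sa 0 4, sa 0 5, sa 0 6, sa 1 2, sa 1 3, sa 1 4,
    sa 1 5, sa 1 6, sa 2 3, sa 2 4, sa 2 5, sa 2 6, sa 3 4, sa 3 5, sa 3 6, sa 4 5, sa 4 6,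
    sa 5 6, hsq, za, mul_neg, neg_neg, neg_zero, mul_zero, smul_zero, add_zero, zero_add,
    smul_neg, ← neg_smul, ← add_smul, smul_eq_zero, htop, or_false]
    at k1 k2 k3 k4 k5 k6 k7 k8 k9
  refine ⟨?_, ?_, ?_, ?_, ?_, ?_⟩ <;> linarith

end helpers

section gens
variable {V : Type*} [AddCommGroup V] [Module ℝ V]

/-- The seven vectors of `ℝ³ × V`. -/
def gvec (v : Fin 4 → V) : Fin (3 + 4) → (Fin 3 → ℝ) × V :=
  Fin.addCases (fun i => (Pi.single i 1, 0)) (fun k => (0, v k))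

/-- The seven generators. -/
def gen (v : Fin 4 → V) (i : Fin 7) : BExt V := ExteriorAlgebra.ι ℝ (gvec v i)

lemma gen_sq (v : Fin 4 → V) (i : Fin 7) : gen v i * gen v i = 0 :=
  ExteriorAlgebra.ι_sq_zero _

lemma gen_anti (v : Fin 4 → V) (i j : Fin 7) : gen v i * gen v j = -(gen v j * gen v i) :=
  eq_neg_of_add_eq_zero_left (ExteriorAlgebra.ι_add_mul_swap _ _)

lemma gen_top (v : Module.Basis (Fin 4) ℝ V) :
    gen v 0 * (gen v 1 * (gen v 2 * (gen v 3 * (gen v 4 * (gen v 5 * gen v 6))))) ≠ 0 := by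
  let B : Module.Basis (Fin 7) ℝ ((Fin 3 → ℝ) × V) :=
    ((Pi.basisFun ℝ (Fin 3)).prod v).reindex finSumFinEquiv
  have hB : (B : Fin 7 → _) = gvec v := by
    funext i
    refine Fin.addCases (m := 3) (n := 4) (fun i => ?_) (fun k => ?_) i
    · have : B (Fin.castAdd 4 i) = (Pi.single i 1, 0) := by
        have h := finSumFinEquiv_symm_apply_castAdd (n := 4) i
        rw [Module.Basis.reindex_apply]
        erw [h]
        simp
      rw [this, gvec, Fin.addCases_left]
    · have : B (Fin.natAdd 3 k) = (0, v k) := by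
        have h := finSumFinEquiv_symm_apply_natAdd (m := 3) k
        rw [Module.Basis.reindex_apply]
        erw [h]
        simp
      rw [this, gvec, Fin.addCases_right]
  have h1 : gen v 0 * (gen v 1 * (gen v 2 * (gen v 3 * (gen v 4 * (gen v 5 * gen v 6)))))
      = ExteriorAlgebra.ιMulti ℝ 7 (gvec v) := by
    rw [ExteriorAlgebra.ιMulti_apply]
    simp [List.ofFn_succ, gen]
  intro h0
  rw [h1] at h0
  let f : ∀ i, ((Fin 3 → ℝ) × V) [⋀^Fin i]→ₗ[ℝ] ℝ :=
    fun i => if h : 7 = i then h ▸ B.det else 0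
  have h2 := ExteriorAlgebra.liftAlternating_apply_ιMulti (R := ℝ) f (gvec v)
  rw [h0, map_zero] at h2
  have h3 : f 7 (gvec v) = 1 := by
    simp only [f, dite_true]
    rw [← hB]; exact B.det_self
  rw [h3] at h2
  exact zero_ne_one h2

lemma rangeW (v : Fin 4 → V) :
    LinearMap.range ((ExteriorAlgebra.ι ℝ).comp (LinearMap.inl ℝ (Fin 3 → ℝ) V))
      = Submodule.span ℝ (Set.range fun i : Fin 3 => gen v (Fin.castAdd 4 i)) := by
  rw [LinearMap.range_eq_map, ← (Pi.basisFun ℝ (Fin 3)).span_eq, Submodule.map_span,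
    ← Set.range_comp]
  congr 2
  funext i
  simp [gen, gvec]

lemma rangeV (v : Module.Basis (Fin 4) ℝ V) :
    LinearMap.range ((ExteriorAlgebra.ι ℝ).comp (LinearMap.inr ℝ (Fin 3 → ℝ) V))
      = Submodule.span ℝ (Set.range fun k : Fin 4 => gen v (Fin.natAdd 3 k)) := by
  rw [LinearMap.range_eq_map, ← v.span_eq, Submodule.map_span, ← Set.range_comp]
  congr 2
  funext i
  simp [gen, gvec]

lemma exists_beta (v : Module.Basis (Fin 4) ℝ V) (β : BExt V) (hβ : β ∈ Omeg V 1 1) :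
    ∃ b, β = betaForm (gen v) b := by
  rw [Omeg, pow_one, pow_one, rangeW v, rangeV v, Submodule.span_mul_span] at hβ
  induction hβ using Submodule.span_induction with
  | mem x hx =>
    obtain ⟨_, ⟨i, rfl⟩, _, ⟨k, rfl⟩, rfl⟩ := hx
    refine ⟨Pi.single i (Pi.single k 1), ?_⟩
    fin_cases i <;> fin_cases k <;>
      simp [betaForm, Fin.sum_univ_four, Pi.single_apply] <;> rfl
  | zero => exact ⟨0, by simp [betaForm]⟩
  | add x y _ _ hx hy =>
    obtain ⟨a, rfl⟩ := hx
    obtain ⟨b, rfl⟩ := hy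
    refine ⟨a + b, ?_⟩
    rw [betaForm, betaForm, betaForm, ← Finset.sum_add_distrib]
    refine Finset.sum_congr rfl fun k _ => ?_
    simp only [Pi.add_apply, add_smul]; abel
  | smul r x _ hx =>
    obtain ⟨a, rfl⟩ := hx
    exact ⟨r • a, by simp [betaForm, Finset.smul_sum, mul_smul]⟩

lemma exists_alpha (v : Module.Basis (Fin 4) ℝ V) (α : BExt V) (hα : α ∈ Omeg V 2 1) :
    ∃ a, α = alphaForm (gen v) a := by
  rw [Omeg, pow_one, pow_two, rangeW v, rangeV v, Submodule.span_mul_span,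
    Submodule.span_mul_span] at hα
  induction hα using Submodule.span_induction with
  | mem x hx =>
    obtain ⟨_, ⟨_, ⟨i, rfl⟩, _, ⟨j, rfl⟩, rfl⟩, _, ⟨k, rfl⟩, rfl⟩ := hx
    have aux : ∀ (m : Fin 3) (r : ℝ), alphaForm (gen v) (Pi.single m (Pi.single k r)) =
        r • (gen v (Fin.castAdd 4 (m + 1)) * (gen v (Fin.castAdd 4 (m + 2)) *
          gen v (Fin.natAdd 3 k))) := by
      intro m r
      fin_cases m <;> fin_cases k <;>
        simp [alphaForm, Fin.sum_univ_four, Pi.single_apply] <;> rfl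
    have hz : (0 : BExt V) = alphaForm (gen v) 0 := by simp [alphaForm]
    have hs : ∀ i : Fin 3, gen v (Fin.castAdd 4 i) * gen v (Fin.castAdd 4 i) *
        gen v (Fin.natAdd 3 k) = 0 := fun i => by rw [gen_sq, zero_mul]
    have hpos : ∀ m : Fin 3, ∃ a, gen v (Fin.castAdd 4 (m + 1)) * gen v (Fin.castAdd 4 (m + 2)) *
        gen v (Fin.natAdd 3 k) = alphaForm (gen v) a := fun m =>
      ⟨Pi.single m (Pi.single k 1), by rw [aux, one_smul, mul_assoc]⟩
    have hneg : ∀ m : Fin 3, ∃ a, gen v (Fin.castAdd 4 (m + 2)) * gen v (Fin.castAdd 4 (m + 1)) *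
        gen v (Fin.natAdd 3 k) = alphaForm (gen v) a := fun m =>
      ⟨Pi.single m (Pi.single k (-1)), by
        rw [aux, neg_one_smul, gen_anti, neg_mul, mul_assoc]⟩
    have hcases : i = j ∨ (∃ m : Fin 3, i = m + 1 ∧ j = m + 2) ∨
        (∃ m : Fin 3, i = m + 2 ∧ j = m + 1) := by
      revert i j; decide
    rcases hcases with rfl | ⟨m, rfl, rfl⟩ | ⟨m, rfl, rfl⟩
    · exact ⟨0, (hs i).trans hz⟩
    · exact hpos m
    · exact hneg m
  | zero => exact ⟨0, by simp [alphaForm]⟩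
  | add x y _ _ hx hy =>
    obtain ⟨a, rfl⟩ := hx
    obtain ⟨b, rfl⟩ := hy
    refine ⟨a + b, ?_⟩
    rw [alphaForm, alphaForm, alphaForm, ← Finset.sum_add_distrib]
    refine Finset.sum_congr rfl fun k _ => ?_
    simp only [Pi.add_apply, add_smul]; abel
  | smul r x _ hx =>
    obtain ⟨a, rfl⟩ := hx
    exact ⟨r • a, by simp [alphaForm, Finset.smul_sum, mul_smul]⟩

end gens

/-- **splitting of (2,1)-forms.** Let `V` be 4-dimensional, `e : ℝ³ → V`
injective, and `ε_n ∈ V` such that `(e(∂₁), e(∂₂), e(∂₃), ε_n)` is a basis of `V`.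
For `α ∈ Λ²(ℝ³)* ⊗ V`:  `α = 0` if and only if `e ∧ α = 0` in `Λ³(ℝ³)* ⊗ Λ²V` and
`ε_n ∧ α` lies in the image of the map `W₁^{∂(1,1)} : Λ¹(ℝ³)* ⊗ V → Λ²(ℝ³)* ⊗ Λ²V`,
`β ↦ e ∧ β`. -/
theorem splitting_of_two_one_forms
    {V : Type*} [AddCommGroup V] [Module ℝ V]
    (hV : Module.finrank ℝ V = 4)
    (e : (Fin 3 → ℝ) →ₗ[ℝ] V) (εn : V)
    (hindep : LinearIndependent ℝ
      (Fin.snoc (fun i : Fin 3 => e (Pi.single i 1)) εn : Fin 4 → V))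
    (hspan : Submodule.span ℝ
      (Set.range (Fin.snoc (fun i : Fin 3 => e (Pi.single i 1)) εn : Fin 4 → V)) = ⊤) :
    ∀ α ∈ Omeg V 2 1,
      (α = 0 ↔ (Eelt e * α = 0 ∧ ∃ β ∈ Omeg V 1 1, ιV εn * α = Eelt e * β)) := by
  intro α hα
  constructor
  · rintro rfl
    exact ⟨mul_zero _, 0, Submodule.zero_mem _, by rw [mul_zero, mul_zero]⟩
  rintro ⟨h1, β, hβ, h2⟩
  let v : Module.Basis (Fin 4) ℝ V := Module.Basis.mk hindep hspan.ge
  have hv : (v : Fin 4 → V) = Fin.snoc (fun i : Fin 3 => e (Pi.single i 1)) εn :=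
    Module.Basis.coe_mk _ _
  obtain ⟨a, rfl⟩ := exists_alpha v α hα
  obtain ⟨b, rfl⟩ := exists_beta v β hβ
  have hW : ∀ i : Fin 3, gen v (Fin.castAdd 4 i) = ιW V (Pi.single i 1) := fun i => by
    rw [gen, gvec, Fin.addCases_left, ιW]
  have hVk : ∀ k : Fin 4, gen v (Fin.natAdd 3 k) = ιV (v k) := fun i => by
    rw [gen, gvec, Fin.addCases_right, ιV]
  have hE : Eelt e = gen v 0 * gen v 3 + gen v 1 * gen v 4 + gen v 2 * gen v 5 := by
    have y0 : gen v 3 = ιV (e (Pi.single 0 1)) := (hVk 0).trans (by rw [hv]; rfl)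
    have y1 : gen v 4 = ιV (e (Pi.single 1 1)) := (hVk 1).trans (by rw [hv]; rfl)
    have y2 : gen v 5 = ιV (e (Pi.single 2 1)) := (hVk 2).trans (by rw [hv]; rfl)
    rw [Eelt, Fin.sum_univ_three, y0, y1, y2, ← hW 0, ← hW 1, ← hW 2]
    rfl
  have hn : ιV εn = gen v 6 := ((hVk 3).trans (by rw [hv]; rfl)).symm
  rw [hE] at h1 h2
  rw [hn] at h2
  obtain ⟨p1, p2, p3, p4, p5, p6⟩ := extract1 _ (gen_sq v) (gen_anti v) (gen_top v) a h1
  obtain ⟨q1, q2, q3, q4, q5, q6⟩ := extract2 _ (gen_sq v) (gen_anti v) (gen_top v) a b h2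
  have ha : a = 0 := by
    funext i k
    fin_cases i <;> fin_cases k <;> simp <;> linarith
  rw [ha]
  simp [alphaForm]
end
end

section
/- (Splitting of (1,2)-forms via cylinder extension) Let V be 4-dimensional, e: R³→V injective, ε_n completing to a basis. For a ∈ Λ¹(R³)*⊗Λ²V: a = 0 if and only if e∧a = 0 and ε_n∧a ∈ Im(W_e^{∂(0,2)}: Λ²V → Λ¹(R³)*⊗Λ³V, x ↦ e∧x). -/
noncomputable section

/-- The general element of the second exterior power of `V`, in coordinates. -/
def twoF {A : Type*} [Ring A] [Algebra ℝ A] (g : Fin 7 → A) (d : Fin 6 → ℝ) : A :=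
  d 0 • (g 3 * g 4) + d 1 • (g 3 * g 5) + d 2 • (g 3 * g 6) + d 3 • (g 4 * g 5)
    + d 4 • (g 4 * g 6) + d 5 • (g 5 * g 6)

set_option maxHeartbeats 4000000 in
theorem coord_core {A : Type*} [Ring A] [Algebra ℝ A] (g : Fin 7 → A)
    (H0 : ∀ i, g i * g i = 0)
    (H1 : ∀ i j, j < i → g i * g j = -(g j * g i))
    (φ : A →ₗ[ℝ] ℝ)
    (hφ : φ (g 0 * (g 1 * (g 2 * (g 3 * (g 4 * (g 5 * g 6)))))) = 1)
    (c : Fin 3 → Fin 6 → ℝ) (d : Fin 6 → ℝ)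
    (h1 : (g 0 * g 3 + g 1 * g 4 + g 2 * g 5) *
      (g 0 * twoF g (c 0) + g 1 * twoF g (c 1) + g 2 * twoF g (c 2)) = 0)
    (h2 : g 6 * (g 0 * twoF g (c 0) + g 1 * twoF g (c 1) + g 2 * twoF g (c 2)) =
      (g 0 * g 3 + g 1 * g 4 + g 2 * g 5) * twoF g d) :
    ∀ i j, c i j = 0 := by
  have H0' : ∀ i z, g i * (g i * z) = 0 := fun i z => by rw [← mul_assoc, H0, zero_mul]
  have H1' : ∀ i j z, j < i → g i * (g j * z) = -(g j * (g i * z)) := fun i j z h => by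
    rw [← mul_assoc, H1 i j h, neg_mul, mul_assoc]
  simp (discharger := decide) only [twoF, mul_add, add_mul, mul_assoc, mul_smul_comm,
    smul_mul_assoc, H0, H0', H1, H1', mul_neg, neg_mul, neg_neg, smul_neg, mul_zero, zero_mul,
    smul_zero, neg_zero, add_zero, zero_add] at h1 h2
  have p03 := congrArg (fun y => φ (g 0 * (g 3 * y))) h1
  have q03 := congrArg (fun y => φ (g 1 * (g 2 * (g 3 * y)))) h2
  have p04 := congrArg (fun y => φ (g 0 * (g 4 * y))) h1
  have q04 := congrArg (fun y => φ (g 1 * (g 2 * (g 4 * y)))) h2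
  have p05 := congrArg (fun y => φ (g 0 * (g 5 * y))) h1
  have q05 := congrArg (fun y => φ (g 1 * (g 2 * (g 5 * y)))) h2
  have p06 := congrArg (fun y => φ (g 0 * (g 6 * y))) h1
  have q06 := congrArg (fun y => φ (g 1 * (g 2 * (g 6 * y)))) h2
  have p13 := congrArg (fun y => φ (g 1 * (g 3 * y))) h1
  have q13 := congrArg (fun y => φ (g 0 * (g 2 * (g 3 * y)))) h2
  have p14 := congrArg (fun y => φ (g 1 * (g 4 * y))) h1
  have q14 := congrArg (fun y => φ (g 0 * (g 2 * (g 4 * y)))) h2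
  have p15 := congrArg (fun y => φ (g 1 * (g 5 * y))) h1
  have q15 := congrArg (fun y => φ (g 0 * (g 2 * (g 5 * y)))) h2
  have p16 := congrArg (fun y => φ (g 1 * (g 6 * y))) h1
  have q16 := congrArg (fun y => φ (g 0 * (g 2 * (g 6 * y)))) h2
  have p23 := congrArg (fun y => φ (g 2 * (g 3 * y))) h1
  have q23 := congrArg (fun y => φ (g 0 * (g 1 * (g 3 * y)))) h2
  have p24 := congrArg (fun y => φ (g 2 * (g 4 * y))) h1
  have q24 := congrArg (fun y => φ (g 0 * (g 1 * (g 4 * y)))) h2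
  have p25 := congrArg (fun y => φ (g 2 * (g 5 * y))) h1
  have q25 := congrArg (fun y => φ (g 0 * (g 1 * (g 5 * y)))) h2
  have p26 := congrArg (fun y => φ (g 2 * (g 6 * y))) h1
  have q26 := congrArg (fun y => φ (g 0 * (g 1 * (g 6 * y)))) h2
  simp (discharger := decide) only [mul_add, mul_smul_comm,
    H0, H0', H1, H1', mul_neg, neg_neg, smul_neg, mul_zero, map_add, map_neg, map_smul,
    map_zero, hφ, smul_eq_mul, mul_one,
    smul_zero, neg_zero, add_zero, zero_add] at p03 q03 p04 q04 p05 q05 p06 q06 p13 q13 p14 q14 p15 q15 p16 q16 p23 q23 p24 q24 p25 q25 p26 q26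
  intro i j
  fin_cases i <;> fin_cases j <;> simp only [Fin.zero_eta, Fin.mk_one, Fin.reduceFinMk] <;> linarith


theorem twoF_add {A : Type*} [Ring A] [Algebra ℝ A] (g : Fin 7 → A) (d d' : Fin 6 → ℝ) :
    twoF g (d + d') = twoF g d + twoF g d' := by
  simp only [twoF, Pi.add_apply]; module

theorem twoF_smul {A : Type*} [Ring A] [Algebra ℝ A] (g : Fin 7 → A) (r : ℝ) (d : Fin 6 → ℝ) :
    twoF g (r • d) = r • twoF g d := by
  simp only [twoF, Pi.smul_apply, smul_eq_mul]; module

theorem twoF_mul {A : Type*} [Ring A] [Algebra ℝ A] (g : Fin 7 → A)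
    (H0 : ∀ i, g i * g i = 0)
    (H1 : ∀ i j, j < i → g i * g j = -(g j * g i)) (s t : Fin 4 → ℝ) :
    (s 0 • g 3 + s 1 • g 4 + s 2 • g 5 + s 3 • g 6) *
      (t 0 • g 3 + t 1 • g 4 + t 2 • g 5 + t 3 • g 6) =
    twoF g ![s 0 * t 1 - s 1 * t 0, s 0 * t 2 - s 2 * t 0, s 0 * t 3 - s 3 * t 0,
      s 1 * t 2 - s 2 * t 1, s 1 * t 3 - s 3 * t 1, s 2 * t 3 - s 3 * t 2] := by
  simp (discharger := decide) only [mul_add, add_mul, mul_smul_comm, smul_mul_assoc, H0, H1]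
  simp [twoF]
  module

/-- **splitting of (1,2)-forms via cylinder extension.** Let `V` be
4-dimensional, `e : ℝ³ → V` injective, and `ε_n ∈ V` completing the image of `e` to a
basis.  For `a ∈ Λ¹(ℝ³)* ⊗ Λ²V`:  `a = 0` if and only if `e ∧ a = 0` and
`ε_n ∧ a ∈ Im(W_e^{∂(0,2)} : Λ²V → Λ¹(ℝ³)* ⊗ Λ³V, x ↦ e ∧ x)`. -/
theorem splitting_of_one_two_forms
    {V : Type*} [AddCommGroup V] [Module ℝ V]
    (hV : Module.finrank ℝ V = 4)
    (e : (Fin 3 → ℝ) →ₗ[ℝ] V) (εn : V)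
    (hindep : LinearIndependent ℝ
      (Fin.snoc (fun i : Fin 3 => e (Pi.single i 1)) εn : Fin 4 → V))
    (hspan : Submodule.span ℝ
      (Set.range (Fin.snoc (fun i : Fin 3 => e (Pi.single i 1)) εn : Fin 4 → V)) = ⊤) :
    ∀ a ∈ Omeg V 1 2,
      (a = 0 ↔ (Eelt e * a = 0 ∧ ∃ x ∈ Omeg V 0 2, ιV εn * a = Eelt e * x)) := by
  intro a ha
  constructor
  · rintro rfl
    exact ⟨mul_zero _, 0, Submodule.zero_mem _, by simp⟩
  rintro ⟨h1, x, hx, h2⟩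
  let bV : Module.Basis (Fin 4) ℝ V := Module.Basis.mk hindep hspan.ge
  let b : Module.Basis (Fin 7) ℝ ((Fin 3 → ℝ) × V) :=
    ((Pi.basisFun ℝ (Fin 3)).prod bV).reindex finSumFinEquiv
  let g : Fin 7 → BExt V := fun i => ExteriorAlgebra.ι ℝ (b i)
  have H0 : ∀ i, g i * g i = 0 := fun i => ExteriorAlgebra.ι_sq_zero _
  have H1 : ∀ i j, j < i → g i * g j = -(g j * g i) := fun i j _ =>
    eq_neg_of_add_eq_zero_left (ExteriorAlgebra.ι_add_mul_swap _ _)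
  have bw : ∀ i : Fin 3, b (Fin.castAdd 4 i) = (Pi.single i 1, 0) := by
    intro i
    have : finSumFinEquiv.symm (Fin.castAdd 4 i) = Sum.inl i := finSumFinEquiv_symm_apply_castAdd i
    rw [Module.Basis.reindex_apply, this]; simp
  have bv : ∀ i : Fin 4, b (Fin.natAdd 3 i) = (0, bV i) := by
    intro i
    have : finSumFinEquiv.symm (Fin.natAdd 3 i) = Sum.inr i := finSumFinEquiv_symm_apply_natAdd i
    rw [Module.Basis.reindex_apply, this]; simp
  have gw : ∀ i : Fin 3, ιW V (Pi.single i 1) = g (Fin.castAdd 4 i) := fun i => by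
    simp only [g, bw, ιW]
  have gv : ∀ i : Fin 4, ιV (bV i) = g (Fin.natAdd 3 i) := fun i => by
    simp only [g, bv, ιV]
  have be : ∀ i : Fin 3, e (Pi.single i 1) = bV (Fin.castSucc i) := fun i => by
    simp [bV, -Fin.castSucc_zero]
  have bε : εn = bV (Fin.last 3) := by simp [bV, -Fin.reduceLast]
  have hE : Eelt e = g 0 * g 3 + g 1 * g 4 + g 2 * g 5 := by
    simp only [Eelt, Fin.sum_univ_three, be, gw, gv]
    rfl
  have hε : ιV εn = g 6 := by rw [bε, gv]; rfl
  have hv : ∀ v : V, ExteriorAlgebra.ι ℝ ((0 : Fin 3 → ℝ), v) = bV.repr v 0 • g 3 + bV.repr v 1 • g 4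
      + bV.repr v 2 • g 5 + bV.repr v 3 • g 6 := by
    intro v
    have : ((0 : Fin 3 → ℝ), v) = bV.repr v 0 • b 3 + bV.repr v 1 • b 4
      + bV.repr v 2 • b 5 + bV.repr v 3 • b 6 := by
      rw [show b 3 = _ from bv 0, show b 4 = _ from bv 1, show b 5 = _ from bv 2,
        show b 6 = _ from bv 3]
      have := bV.sum_repr v
      rw [Fin.sum_univ_four] at this
      ext1
      · simp
      · simp [this]
    rw [this]
    simp only [map_add, map_smul, g]
  have hw : ∀ w : Fin 3 → ℝ, ExteriorAlgebra.ι ℝ (w, (0 : V)) =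
      w 0 • g 0 + w 1 • g 1 + w 2 • g 2 := by
    intro w
    have : (w, (0 : V)) = w 0 • b 0 + w 1 • b 1 + w 2 • b 2 := by
      rw [show b 0 = _ from bw 0, show b 1 = _ from bw 1, show b 2 = _ from bw 2]
      ext1
      · ext i
        fin_cases i <;> simp
      · simp
    rw [this]
    simp only [map_add, map_smul, g]
  have two : ∀ y ∈ (LinearMap.range ((ExteriorAlgebra.ι ℝ).comp
      (LinearMap.inr ℝ (Fin 3 → ℝ) V))) ^ 2, ∃ d, y = twoF g d := by
    intro y hy
    rw [pow_two] at hy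
    induction hy using Submodule.mul_induction_on' with
    | mem_mul_mem m hm n hn =>
      obtain ⟨v, rfl⟩ := hm
      obtain ⟨u, rfl⟩ := hn
      simp only [LinearMap.comp_apply, LinearMap.inr_apply, hv]
      exact ⟨_, twoF_mul g H0 H1 _ _⟩
    | add x _ y _ hx hy =>
      obtain ⟨d, rfl⟩ := hx
      obtain ⟨d', rfl⟩ := hy
      exact ⟨d + d', (twoF_add _ _ _).symm⟩
  obtain ⟨d, rfl⟩ : ∃ d, x = twoF g d := by
    apply two
    simpa only [Omeg, pow_zero, one_mul] using hx
  obtain ⟨c, rfl⟩ : ∃ c : Fin 3 → Fin 6 → ℝ,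
      a = g 0 * twoF g (c 0) + g 1 * twoF g (c 1) + g 2 * twoF g (c 2) := by
    clear h1 h2
    rw [Omeg, pow_one] at ha
    induction ha using Submodule.mul_induction_on' with
    | mem_mul_mem m hm n hn =>
      obtain ⟨w, rfl⟩ := hm
      obtain ⟨d, rfl⟩ := two n hn
      refine ⟨fun i => w i • d, ?_⟩
      simp only [LinearMap.comp_apply, LinearMap.inl_apply, hw, twoF_smul, add_mul,
        smul_mul_assoc, mul_smul_comm]
    | add x _ y _ hx hy =>
      obtain ⟨d, rfl⟩ := hx
      obtain ⟨d', rfl⟩ := hy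
      refine ⟨d + d', ?_⟩
      simp only [Pi.add_apply, twoF_add, mul_add]
      abel
  let φ : BExt V →ₗ[ℝ] ℝ := ExteriorAlgebra.liftAlternating (Pi.single 7 b.det)
  have hφ : φ (g 0 * (g 1 * (g 2 * (g 3 * (g 4 * (g 5 * g 6)))))) = 1 := by
    have h := ExteriorAlgebra.liftAlternating_apply_ιMulti (R := ℝ)
      (Pi.single 7 b.det : ∀ i, ((Fin 3 → ℝ) × V) [⋀^Fin i]→ₗ[ℝ] ℝ) (b : Fin 7 → _)
    rw [Pi.single_eq_same, b.det_self, ExteriorAlgebra.ιMulti_apply] at h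
    rw [← h]
    simp only [φ, g, List.ofFn_succ, List.ofFn_zero, List.prod_cons, List.prod_nil, mul_one]
    rfl
  rw [hE] at h1 h2
  rw [hε] at h2
  have hc := coord_core g H0 H1 φ hφ c d h1 h2
  simp [twoF, hc]
end
end

section
/- (Decomposition of (1,3)-forms) Let V be 4-dimensional, e: R³→V injective, ε_n completing to a basis. Then Λ¹(R³)*⊗Λ³V decomposes as a direct sum: for every Θ ∈ Λ¹(R³)*⊗Λ³V there exist unique α ∈ Λ²V and β ∈ Ker(W_e^{∂(1,2)}) ⊂ Λ¹(R³)*⊗Λ²V such that Θ = e∧α + ε_n∧β. In particular the map Ker(W_e^{∂(1,2)}) → Λ¹(R³)*⊗Λ³V, β ↦ ε_n∧β is injective, its image has dimension 6, and intersects the 6-dimensional image of W_e^{∂(0,2)} only in 0. -/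
noncomputable section

set_option linter.unusedSimpArgs false

/-- Anticommuting families `w₀,w₁,w₂` and `v₀,…,v₃` in an algebra, with nonzero total product. -/
structure AntiFam {A : Type*} [Ring A] [Algebra ℝ A] (w : Fin 3 → A) (v : Fin 4 → A) : Prop where
  ww : ∀ i, w i * w i = 0
  vv : ∀ i, v i * v i = 0
  wsw : ∀ i j, j < i → w i * w j = -(w j * w i)
  vsw : ∀ i j, j < i → v i * v j = -(v j * v i)
  vw : ∀ i j, v i * w j = -(w j * v i)
  top : (w 0 * (w 1 * w 2)) * (v 0 * (v 1 * (v 2 * v 3))) ≠ 0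

namespace AntiFam

variable {A : Type*} [Ring A] [Algebra ℝ A] {w : Fin 3 → A} {v : Fin 4 → A}

theorem ww' (h : AntiFam w v) (i) (x : A) : w i * (w i * x) = 0 := by
  rw [← mul_assoc, h.ww, zero_mul]

theorem vv' (h : AntiFam w v) (i) (x : A) : v i * (v i * x) = 0 := by
  rw [← mul_assoc, h.vv, zero_mul]

theorem wsw' (h : AntiFam w v) (i j) (hij : j < i) (x : A) :
    w i * (w j * x) = -(w j * (w i * x)) := by
  rw [← mul_assoc, h.wsw i j hij, neg_mul, mul_assoc]

theorem vsw' (h : AntiFam w v) (i j) (hij : j < i) (x : A) :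
    v i * (v j * x) = -(v j * (v i * x)) := by
  rw [← mul_assoc, h.vsw i j hij, neg_mul, mul_assoc]

theorem vw' (h : AntiFam w v) (i j) (x : A) :
    v i * (w j * x) = -(w j * (v i * x)) := by
  rw [← mul_assoc, h.vw i j, neg_mul, mul_assoc]

/-- Quadratic monomials in the `w`. -/
def W2 (w : Fin 3 → A) : Fin 3 → A := ![w 1 * w 2, -(w 0 * w 2), w 0 * w 1]

/-- Quadratic monomials in the `v`. -/
def V2 (v : Fin 4 → A) : Fin 6 → A :=
  ![v 0 * v 1, v 0 * v 2, v 1 * v 2, v 0 * v 3, v 1 * v 3, v 2 * v 3]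

/-- Cubic monomials in the `v`. -/
def V3 (v : Fin 4 → A) : Fin 4 → A :=
  ![-(v 1 * (v 2 * v 3)), v 0 * (v 2 * v 3), -(v 0 * (v 1 * v 3)), v 0 * (v 1 * v 2)]

/-- The coframe. -/
def E (w : Fin 3 → A) (v : Fin 4 → A) : A := w 0 * v 0 + w 1 * v 1 + w 2 * v 2

theorem W2_mul (h : AntiFam w v) (i j : Fin 3) :
    W2 w i * w j = if i = j then w 0 * (w 1 * w 2) else 0 := by
  fin_cases i <;> fin_cases j <;>
    simp [W2, mul_assoc, h.ww, h.ww', h.wsw, h.wsw']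

theorem mul_W2 (h : AntiFam w v) (i j : Fin 3) :
    w j * W2 w i = if i = j then w 0 * (w 1 * w 2) else 0 := by
  fin_cases i <;> fin_cases j <;>
    simp [W2, h.ww, h.ww', h.wsw, h.wsw']

theorem V3_mul (h : AntiFam w v) (i j : Fin 4) :
    V3 v i * v j = if i = j then v 0 * (v 1 * (v 2 * v 3)) else 0 := by
  fin_cases i <;> fin_cases j <;>
    simp [V3, mul_assoc, h.vv, h.vv', h.vsw, h.vsw']

theorem li_aux (f g : Fin 3 → A) (p q : Fin 4 → A) (s t : A) (hst : s * t ≠ 0)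
    (hf : ∀ i j, g j * f i = if i = j then s else 0)
    (hp : ∀ i j, p i * q j = if i = j then t else 0) :
    LinearIndependent ℝ (fun x : Fin 3 × Fin 4 => f x.1 * p x.2) := by
  rw [Fintype.linearIndependent_iff]
  intro c hc y
  have h1 := congrArg (fun z => g y.1 * z * q y.2) hc
  simp only [Finset.mul_sum, Finset.sum_mul, mul_zero, zero_mul] at h1
  rw [Finset.sum_eq_single y] at h1
  · have : g y.1 * (c y • (f y.1 * p y.2)) * q y.2 = c y • ((g y.1 * f y.1) * (p y.2 * q y.2)) := by
      simp [mul_assoc]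
    rw [this, hf, hp] at h1
    simpa [hst] using h1
  · intro x _ hx
    have : g y.1 * (c x • (f x.1 * p x.2)) * q y.2 = c x • ((g y.1 * f x.1) * (p x.2 * q y.2)) := by
      simp [mul_assoc]
    rw [this, hf, hp]
    by_cases h1 : x.1 = y.1
    · have h2 : x.2 ≠ y.2 := fun h2 => hx (Prod.ext h1 h2)
      simp [h2]
    · simp [h1]
  · simp

theorem li13 (h : AntiFam w v) :
    LinearIndependent ℝ (fun x : Fin 3 × Fin 4 => w x.1 * V3 v x.2) :=
  li_aux w (W2 w) (V3 v) v _ _ h.top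
    (fun i j => by rw [h.W2_mul]; simp [eq_comm]) (fun i j => h.V3_mul i j)

theorem li23 (h : AntiFam w v) :
    LinearIndependent ℝ (fun x : Fin 3 × Fin 4 => W2 w x.1 * V3 v x.2) :=
  li_aux (W2 w) w (V3 v) v _ _ h.top
    (fun i j => h.mul_W2 i j) (fun i j => h.V3_mul i j)

open Submodule in
theorem span_mul_range {ι κ : Type*} (f : ι → A) (g : κ → A) :
    span ℝ (Set.range f) * span ℝ (Set.range g)
      = span ℝ (Set.range fun x : ι × κ => f x.1 * g x.2) := by
  rw [span_mul_span]
  congr 1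
  ext x
  simp [Set.mem_mul]

open Submodule in
theorem RV2 (h : AntiFam w v) : span ℝ (Set.range v) ^ 2 = span ℝ (Set.range (V2 v)) := by
  rw [pow_two, span_mul_range]
  apply le_antisymm
  · rw [span_le]
    rintro _ ⟨⟨i, j⟩, rfl⟩
    have hm : ∀ k, V2 v k ∈ span ℝ (Set.range (V2 v)) := fun k => subset_span ⟨k, rfl⟩
    have h0 := hm 0
    have h1 := hm 1
    have h2 := hm 2
    have h3 := hm 3
    have h4 := hm 4
    have h5 := hm 5
    generalize span ℝ (Set.range (V2 v)) = S at *
    simp only [V2] at h0 h1 h2 h3 h4 h5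
    simp at h0 h1 h2 h3 h4 h5
    fin_cases i <;> fin_cases j <;> simp [h.vv, h.vsw, *]
  · rw [span_le]
    rintro _ ⟨k, rfl⟩
    have hm : ∀ i j, v i * v j ∈ span ℝ (Set.range fun x : Fin 4 × Fin 4 => v x.1 * v x.2) :=
      fun i j => subset_span ⟨(i, j), rfl⟩
    fin_cases k <;> exact hm _ _

open Submodule in
theorem RV3 (h : AntiFam w v) : span ℝ (Set.range v) ^ 3 = span ℝ (Set.range (V3 v)) := by
  rw [pow_succ, h.RV2, span_mul_range]
  apply le_antisymm
  · rw [span_le]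
    rintro _ ⟨⟨i, j⟩, rfl⟩
    have hm : ∀ k, V3 v k ∈ span ℝ (Set.range (V3 v)) := fun k => subset_span ⟨k, rfl⟩
    have h0 := hm 0
    have h1 := hm 1
    have h2 := hm 2
    have h3 := hm 3
    generalize span ℝ (Set.range (V3 v)) = S at *
    simp only [V3] at h0 h1 h2 h3
    simp at h0 h1 h2 h3
    fin_cases i <;> fin_cases j <;> simp [V2, mul_assoc, h.vv, h.vv', h.vsw, h.vsw', *]
  · rw [span_le]
    rintro _ ⟨k, rfl⟩
    have hm : ∀ i j, V2 v i * v j ∈ span ℝ (Set.range fun x : Fin 6 × Fin 4 => V2 v x.1 * v x.2) :=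
      fun i j => subset_span ⟨(i, j), rfl⟩
    have h0 := hm 2 3
    have h1 := hm 1 3
    have h2 := hm 0 3
    have h3 := hm 0 2
    generalize span ℝ (Set.range fun x : Fin 6 × Fin 4 => V2 v x.1 * v x.2) = S at *
    simp only [V2] at h0 h1 h2 h3
    simp [mul_assoc] at h0 h1 h2 h3
    fin_cases k <;> simp [V3, *]

open Submodule in
/-- surjectivity of `E ∧ · : Ω^(1,2) → Ω^(2,3)` -/
theorem surj12 (h : AntiFam w v) :
    span ℝ (Set.range fun x : Fin 3 × Fin 4 => W2 w x.1 * V3 v x.2) ≤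
      map (LinearMap.mulLeft ℝ (E w v))
        (span ℝ (Set.range fun x : Fin 3 × Fin 6 => w x.1 * V2 v x.2)) := by
  rw [span_le]
  have hm : ∀ i j, E w v * (w i * V2 v j) ∈ map (LinearMap.mulLeft ℝ (E w v))
        (span ℝ (Set.range fun x : Fin 3 × Fin 6 => w x.1 * V2 v x.2)) :=
    fun i j => ⟨_, subset_span ⟨(i, j), rfl⟩, rfl⟩
  generalize map (LinearMap.mulLeft ℝ (E w v))
        (span ℝ (Set.range fun x : Fin 3 × Fin 6 => w x.1 * V2 v x.2)) = S at *
  have key : ∀ a b c : A, a + b ∈ S → a + c ∈ S → b + c ∈ S → a ∈ S := by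
    intro a b c h1 h2 h3
    have : a = (1 / 2 : ℝ) • ((a + b) + (a + c) - (b + c)) := by module
    rw [this]
    exact S.smul_mem _ (S.sub_mem (S.add_mem h1 h2) h3)
  have hX0 : w 0 * (w 1 * (v 0 * (v 1 * v 3))) + w 0 * (w 2 * (v 0 * (v 2 * v 3))) ∈ S := by
    rw [← S.neg_mem_iff]
    convert hm 0 3 using 1
    simp [E, V2, add_mul, mul_assoc, h.ww', h.vv', h.wsw', h.vsw', h.vw']
    abel
  have hX1 : w 0 * (w 1 * (v 0 * (v 1 * v 3))) + w 1 * (w 2 * (v 1 * (v 2 * v 3))) ∈ S := by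
    rw [← S.neg_mem_iff]
    convert hm 1 4 using 1
    simp [E, V2, add_mul, mul_assoc, h.ww', h.vv', h.wsw', h.vsw', h.vw']
    abel
  have hX2 : w 0 * (w 2 * (v 0 * (v 2 * v 3))) + w 1 * (w 2 * (v 1 * (v 2 * v 3))) ∈ S := by
    rw [← S.neg_mem_iff]
    convert hm 2 5 using 1
    simp [E, V2, add_mul, mul_assoc, h.ww', h.vv', h.wsw', h.vsw', h.vw']
    abel
  have h01 := key _ _ _ hX0 hX1 hX2
  have h02 := key _ _ _ (by rwa [add_comm] at hX0) hX2 hX1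
  have h12 := key _ _ _ (by rwa [add_comm] at hX1) (by rwa [add_comm] at hX2) hX0
  have a1 := hm 0 2
  have a2 := hm 1 1
  have a3 := hm 2 0
  have b1 := hm 0 4
  have b2 := hm 0 5
  have b3 := hm 1 3
  have b4 := hm 1 5
  have b5 := hm 2 3
  have b6 := hm 2 4
  have c1 := hm 1 2
  have c2 := hm 2 1
  have c3 := hm 2 2
  simp [E, V2, add_mul, mul_assoc, h.ww', h.vv, h.vv', h.vsw, h.wsw', h.vsw', h.vw']
    at a1 a2 a3 b1 b2 b3 b4 b5 b6 c1 c2 c3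
  rintro _ ⟨⟨i, j⟩, rfl⟩
  fin_cases i <;> fin_cases j <;> simp [W2, V3, mul_assoc, *]

open Submodule in
/-- every `(1,3)` form is `E ∧ α + v₃ ∧ β` with `E ∧ β = 0`. -/
theorem surj13 (h : AntiFam w v) :
    span ℝ (Set.range fun x : Fin 3 × Fin 4 => w x.1 * V3 v x.2) ≤
      map (LinearMap.mulLeft ℝ (E w v)) (span ℝ (Set.range (V2 v))) ⊔
      map (LinearMap.mulLeft ℝ (v 3))
        (span ℝ (Set.range fun x : Fin 3 × Fin 6 => w x.1 * V2 v x.2) ⊓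
          LinearMap.ker (LinearMap.mulLeft ℝ (E w v))) := by
  rw [span_le]
  have hg : ∀ i j, w i * V2 v j ∈ span ℝ (Set.range fun x : Fin 3 × Fin 6 => w x.1 * V2 v x.2) :=
    fun i j => subset_span ⟨(i, j), rfl⟩
  generalize span ℝ (Set.range fun x : Fin 3 × Fin 6 => w x.1 * V2 v x.2) = G at *
  have hE : ∀ j, E w v * V2 v j ∈ map (LinearMap.mulLeft ℝ (E w v)) (span ℝ (Set.range (V2 v))) ⊔
      map (LinearMap.mulLeft ℝ (v 3)) (G ⊓ LinearMap.ker (LinearMap.mulLeft ℝ (E w v))) :=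
    fun j => mem_sup_left ⟨_, subset_span ⟨j, rfl⟩, rfl⟩
  have hK : ∀ x ∈ G, E w v * x = 0 → v 3 * x ∈
      map (LinearMap.mulLeft ℝ (E w v)) (span ℝ (Set.range (V2 v))) ⊔
      map (LinearMap.mulLeft ℝ (v 3)) (G ⊓ LinearMap.ker (LinearMap.mulLeft ℝ (E w v))) :=
    fun x hx hx0 => mem_sup_right ⟨x, ⟨hx, hx0⟩, rfl⟩
  generalize map (LinearMap.mulLeft ℝ (E w v)) (span ℝ (Set.range (V2 v))) ⊔
      map (LinearMap.mulLeft ℝ (v 3)) (G ⊓ LinearMap.ker (LinearMap.mulLeft ℝ (E w v))) = S at *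
  have key : ∀ a b : A, a + b ∈ S → a - b ∈ S → a ∈ S ∧ b ∈ S := by
    intro a b h1 h2
    have ha : a = (1 / 2 : ℝ) • ((a + b) + (a - b)) := by module
    have hb : b = (1 / 2 : ℝ) • ((a + b) - (a - b)) := by module
    constructor
    · rw [ha]
      exact S.smul_mem _ (S.add_mem h1 h2)
    · rw [hb]
      exact S.smul_mem _ (S.sub_mem h1 h2)
  have a1 := hE 0
  have a2 := hE 1
  have a3 := hE 2
  have b1 := hK _ (hg 0 2)
    (by simp [E, V2, add_mul, mul_assoc, h.ww', h.vv, h.vv', h.vsw, h.wsw', h.vsw', h.vw'])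
  have b2 := hK _ (hg 1 1)
    (by simp [E, V2, add_mul, mul_assoc, h.ww', h.vv, h.vv', h.vsw, h.wsw', h.vsw', h.vw'])
  have b3 := hK _ (hg 2 0)
    (by simp [E, V2, add_mul, mul_assoc, h.ww', h.vv, h.vv', h.vsw, h.wsw', h.vsw', h.vw'])
  simp [E, V2, add_mul, mul_assoc, h.ww', h.vv, h.vv', h.vsw, h.wsw', h.vsw', h.vw']
    at a1 a2 a3 b1 b2 b3
  have c0 := key (w 1 * (v 0 * (v 1 * v 3))) (w 2 * (v 0 * (v 2 * v 3)))
    (by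
      rw [← S.neg_mem_iff]
      convert hE 3 using 1
      simp [E, V2, add_mul, mul_assoc, h.ww', h.vv, h.vv', h.vsw, h.wsw', h.vsw', h.vw']
      abel)
    (by
      rw [← S.neg_mem_iff]
      convert hK _ (G.sub_mem (hg 1 0) (hg 2 1)) (by
        simp [E, V2, add_mul, mul_sub, mul_assoc, h.ww', h.vv, h.vv', h.vsw, h.wsw', h.vsw', h.vw']
        try abel) using 1
      simp [V2, mul_sub, mul_assoc, h.vsw, h.vsw', h.vw']
      try abel)
  have c1 := key (w 0 * (v 0 * (v 1 * v 3))) (w 2 * -(v 1 * (v 2 * v 3)))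
    (by
      convert hE 4 using 1
      simp [E, V2, add_mul, mul_assoc, h.ww', h.vv, h.vv', h.vsw, h.wsw', h.vsw', h.vw'])
    (by
      rw [← S.neg_mem_iff]
      convert hK _ (G.add_mem (hg 0 0) (hg 2 2)) (by
        simp [E, V2, add_mul, mul_add, mul_assoc, h.ww', h.vv, h.vv', h.vsw, h.wsw', h.vsw', h.vw']
        try abel) using 1
      simp [V2, mul_add, mul_assoc, h.vsw, h.vsw', h.vw']
      try abel)
  have c2 := key (w 0 * (v 0 * (v 2 * v 3))) (w 1 * (v 1 * (v 2 * v 3)))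
    (by
      convert hE 5 using 1
      simp [E, V2, add_mul, mul_assoc, h.ww', h.vv, h.vv', h.vsw, h.wsw', h.vsw', h.vw'])
    (by
      rw [← S.neg_mem_iff]
      convert hK _ (G.sub_mem (hg 0 1) (hg 1 2)) (by
        simp [E, V2, add_mul, mul_sub, mul_assoc, h.ww', h.vv, h.vv', h.vsw, h.wsw', h.vsw', h.vw']
        try abel) using 1
      simp [V2, mul_sub, mul_assoc, h.vsw, h.vsw', h.vw']
      try abel)
  obtain ⟨c01, c02⟩ := c0
  obtain ⟨c11, c12⟩ := c1
  obtain ⟨c21, c22⟩ := c2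
  simp at c12
  rintro _ ⟨⟨i, j⟩, rfl⟩
  fin_cases i <;> fin_cases j <;> simp [V3, *]

open Submodule Module in
theorem finrank_ker_le (h : AntiFam w v) :
    finrank ℝ ↥(span ℝ (Set.range fun x : Fin 3 × Fin 6 => w x.1 * V2 v x.2) ⊓
          LinearMap.ker (LinearMap.mulLeft ℝ (E w v))) ≤ 6 := by
  have hs := h.surj12
  have h18 : finrank ℝ ↥(span ℝ (Set.range fun x : Fin 3 × Fin 6 => w x.1 * V2 v x.2)) ≤ 18 :=
    finrank_range_le_card _
  have h12 := finrank_span_eq_card h.li23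
  have : FiniteDimensional ℝ
      ↥(span ℝ (Set.range fun x : Fin 3 × Fin 6 => w x.1 * V2 v x.2)) :=
    FiniteDimensional.span_of_finite ℝ (Set.finite_range _)
  generalize span ℝ (Set.range fun x : Fin 3 × Fin 6 => w x.1 * V2 v x.2) = G at *
  have h1 := LinearMap.finrank_range_add_finrank_ker ((LinearMap.mulLeft ℝ (E w v)).domRestrict G)
  rw [LinearMap.range_domRestrict] at h1
  have h2 := finrank_mono hs
  have h3 : map G.subtype (LinearMap.ker ((LinearMap.mulLeft ℝ (E w v)).domRestrict G)) =
      G ⊓ LinearMap.ker (LinearMap.mulLeft ℝ (E w v)) := by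
    ext x
    simp [and_comm]
  rw [← h3, finrank_map_subtype_eq]
  simp at h12
  omega

/-- linear algebra: a surjection from a product of dimension at most 12 onto dimension 12. -/
theorem linalg {M : Type*} [AddCommGroup M] [Module ℝ M] (f g : M →ₗ[ℝ] M)
    (P Q R : Submodule ℝ M) [FiniteDimensional ℝ P] [FiniteDimensional ℝ Q]
    (hP : Module.finrank ℝ P ≤ 6) (hQ : Module.finrank ℝ Q ≤ 6) (hR : Module.finrank ℝ R = 12)
    (hle : R ≤ P.map f ⊔ Q.map g) :
    (∀ x ∈ R, ∃! p : M × M, p.1 ∈ P ∧ p.2 ∈ Q ∧ x = f p.1 + g p.2) ∧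
    (∀ y ∈ Q, g y = 0 → y = 0) ∧
    Module.finrank ℝ (Q.map g) = 6 ∧ Module.finrank ℝ (P.map f) = 6 ∧
    Q.map g ⊓ P.map f = ⊥ := by
  have h1 := Submodule.finrank_mono hle
  have h2 := Submodule.finrank_sup_add_finrank_inf_eq (P.map f) (Q.map g)
  have h3 := Submodule.finrank_map_le f P
  have h4 := Submodule.finrank_map_le g Q
  have h5 : Module.finrank ℝ ↥(P.map f ⊓ Q.map g) = 0 := by omega
  have h6 : P.map f ⊓ Q.map g = ⊥ := Submodule.finrank_eq_zero.mp h5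
  have inj : ∀ (f : M →ₗ[ℝ] M) (P : Submodule ℝ M) [FiniteDimensional ℝ P],
      Module.finrank ℝ P ≤ Module.finrank ℝ (P.map f) → ∀ y ∈ P, f y = 0 → y = 0 := by
    intro f P _ hh y hy h0
    have h7 := LinearMap.finrank_range_add_finrank_ker (f.domRestrict P)
    rw [LinearMap.range_domRestrict] at h7
    have h8 : LinearMap.ker (f.domRestrict P) = ⊥ := Submodule.finrank_eq_zero.mp (by omega)
    have h9 : (⟨y, hy⟩ : P) ∈ LinearMap.ker (f.domRestrict P) := by simpa using h0
    rw [h8] at h9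
    simpa using h9
  have hf := inj f P (by omega)
  have hg := inj g Q (by omega)
  refine ⟨?_, hg, by omega, by omega, by rw [inf_comm]; exact h6⟩
  intro x hx
  obtain ⟨_, ⟨a, ha, rfl⟩, _, ⟨b, hb, rfl⟩, hab⟩ := Submodule.mem_sup.mp (hle hx)
  refine ⟨(a, b), ⟨ha, hb, hab.symm⟩, ?_⟩
  rintro ⟨a', b'⟩ ⟨ha', hb', hab'⟩
  simp only at ha' hb' hab'
  have e1 : f (a' - a) = g (b - b') := by
    rw [map_sub, map_sub, sub_eq_sub_iff_add_eq_add, ← hab', ← hab]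
    abel
  have m1 : f (a' - a) ∈ P.map f ⊓ Q.map g :=
    ⟨⟨_, P.sub_mem ha' ha, rfl⟩, by rw [e1]; exact ⟨_, Q.sub_mem hb hb', rfl⟩⟩
  rw [h6, Submodule.mem_bot] at m1
  have z1 := hf _ (P.sub_mem ha' ha) m1
  have z2 := hg _ (Q.sub_mem hb hb') (e1 ▸ m1)
  rw [sub_eq_zero] at z1 z2
  rw [z1, z2]

end AntiFam

open Submodule in
theorem range_eq_span {M N : Type*} [AddCommGroup M] [Module ℝ M] [AddCommGroup N] [Module ℝ N]
    {ι : Type*} (f : M →ₗ[ℝ] N) (b : ι → M) (hb : span ℝ (Set.range b) = ⊤) :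
    LinearMap.range f = span ℝ (Set.range fun i => f (b i)) := by
  rw [LinearMap.range_eq_map, ← hb, map_span, ← Set.range_comp]
  rfl

theorem antiFam_of_basis {V : Type*} [AddCommGroup V] [Module ℝ V] (u : Fin 4 → V)
    (hu : LinearIndependent ℝ u) (hs : Submodule.span ℝ (Set.range u) = ⊤) :
    AntiFam (fun i => ιW V (Pi.single i 1)) (fun i => ιV (u i)) := by
  have sw : ∀ x y : (Fin 3 → ℝ) × V, ExteriorAlgebra.ι ℝ x * ExteriorAlgebra.ι ℝ y =
      -(ExteriorAlgebra.ι ℝ y * ExteriorAlgebra.ι ℝ x) :=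
    fun x y => eq_neg_of_add_eq_zero_left (ExteriorAlgebra.ι_add_mul_swap x y)
  refine ⟨fun i => ExteriorAlgebra.ι_sq_zero _, fun i => ExteriorAlgebra.ι_sq_zero _,
    fun i j _ => sw _ _, fun i j _ => sw _ _, fun i j => sw _ _, ?_⟩
  let B : Module.Basis (Fin 7) ℝ ((Fin 3 → ℝ) × V) :=
    ((Pi.basisFun ℝ (Fin 3)).prod (Module.Basis.mk hu hs.ge)).reindex finSumFinEquiv
  have hB : ExteriorAlgebra.ιMulti ℝ 7 B ≠ 0 := by
    intro h0
    let F : ∀ i, ((Fin 3 → ℝ) × V) [⋀^Fin i]→ₗ[ℝ] ℝ :=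
      Function.update (fun _ => 0) 7 B.det
    have h1 := congrArg (ExteriorAlgebra.liftAlternating F) h0
    rw [ExteriorAlgebra.liftAlternating_apply_ιMulti, map_zero] at h1
    simp [F, B.det_self] at h1
  have b0 : B 0 = (Pi.single 0 1, 0) := by
    have : (0 : Fin 7) = finSumFinEquiv (Sum.inl (0 : Fin 3) : Fin 3 ⊕ Fin 4) := rfl
    rw [this]; simp [B]
  have b1 : B 1 = (Pi.single 1 1, 0) := by
    have : (1 : Fin 7) = finSumFinEquiv (Sum.inl (1 : Fin 3) : Fin 3 ⊕ Fin 4) := rfl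
    rw [this]; simp [B]
  have b2 : B 2 = (Pi.single 2 1, 0) := by
    have : (2 : Fin 7) = finSumFinEquiv (Sum.inl (2 : Fin 3) : Fin 3 ⊕ Fin 4) := rfl
    rw [this]; simp [B]
  have b3 : B 3 = (0, u 0) := by
    have : (3 : Fin 7) = finSumFinEquiv (Sum.inr (0 : Fin 4)) := rfl
    rw [this]; simp [B]
  have b4 : B 4 = (0, u 1) := by
    have : (4 : Fin 7) = finSumFinEquiv (Sum.inr (1 : Fin 4)) := rfl
    rw [this]; simp [B]
  have b5 : B 5 = (0, u 2) := by
    have : (5 : Fin 7) = finSumFinEquiv (Sum.inr (2 : Fin 4)) := rfl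
    rw [this]; simp [B]
  have b6 : B 6 = (0, u 3) := by
    have : (6 : Fin 7) = finSumFinEquiv (Sum.inr (3 : Fin 4)) := rfl
    rw [this]; simp [B]
  intro h0
  apply hB
  rw [← h0, ExteriorAlgebra.ιMulti_apply]
  simp [List.ofFn_succ, ιW, ιV, mul_assoc, ← b0, ← b1, ← b2, ← b3, ← b4, ← b5, ← b6]

/-- **decomposition of (1,3)-forms.** Let `V` be 4-dimensional,
`e : ℝ³ → V` injective, and `ε_n` completing to a basis.  Then `Λ¹(ℝ³)* ⊗ Λ³V`
decomposes as a direct sum:  every `Θ` admits unique `α ∈ Λ²V` and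
`β ∈ Ker(W_e^{∂(1,2)})` with `Θ = e ∧ α + ε_n ∧ β`.  In particular
`β ↦ ε_n ∧ β` is injective on `Ker(W_e^{∂(1,2)})`, its image has dimension 6, and it
intersects the 6-dimensional image of `W_e^{∂(0,2)}` only in `0`. -/
theorem decomposition_of_one_three_forms
    {V : Type*} [AddCommGroup V] [Module ℝ V]
    (hV : Module.finrank ℝ V = 4)
    (e : (Fin 3 → ℝ) →ₗ[ℝ] V) (εn : V)
    (hindep : LinearIndependent ℝ
      (Fin.snoc (fun i : Fin 3 => e (Pi.single i 1)) εn : Fin 4 → V))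
    (hspan : Submodule.span ℝ
      (Set.range (Fin.snoc (fun i : Fin 3 => e (Pi.single i 1)) εn : Fin 4 → V)) = ⊤) :
    (∀ Θ ∈ Omeg V 1 3,
      ∃! p : BExt V × BExt V,
        p.1 ∈ Omeg V 0 2 ∧ (p.2 ∈ Omeg V 1 2 ∧ Eelt e * p.2 = 0) ∧
          Θ = Eelt e * p.1 + ιV εn * p.2)
    ∧ (∀ β, β ∈ Omeg V 1 2 → Eelt e * β = 0 → ιV εn * β = 0 → β = 0)
    ∧ Module.finrank ℝ
        ↥(Submodule.map (LinearMap.mulLeft ℝ (ιV εn))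
            (Omeg V 1 2 ⊓ LinearMap.ker (LinearMap.mulLeft ℝ (Eelt e)))) = 6
    ∧ Module.finrank ℝ
        ↥(Submodule.map (LinearMap.mulLeft ℝ (Eelt e)) (Omeg V 0 2)) = 6
    ∧ Submodule.map (LinearMap.mulLeft ℝ (ιV εn))
          (Omeg V 1 2 ⊓ LinearMap.ker (LinearMap.mulLeft ℝ (Eelt e)))
        ⊓ Submodule.map (LinearMap.mulLeft ℝ (Eelt e)) (Omeg V 0 2) = ⊥ := by
  set u : Fin 4 → V := Fin.snoc (fun i : Fin 3 => e (Pi.single i 1)) εn with hu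
  have h := antiFam_of_basis u hindep hspan
  have u0 : u 0 = e (Pi.single 0 1) := rfl
  have u1 : u 1 = e (Pi.single 1 1) := rfl
  have u2 : u 2 = e (Pi.single 2 1) := rfl
  have u3 : u 3 = εn := rfl
  have hRW : LinearMap.range ((ExteriorAlgebra.ι ℝ).comp (LinearMap.inl ℝ (Fin 3 → ℝ) V)) =
      Submodule.span ℝ (Set.range fun i : Fin 3 => ιW V (Pi.single i 1)) := by
    rw [range_eq_span _ (Pi.basisFun ℝ (Fin 3)) (Module.Basis.span_eq _)]
    simp [ιW]
  have hRV : LinearMap.range ((ExteriorAlgebra.ι ℝ).comp (LinearMap.inr ℝ (Fin 3 → ℝ) V)) =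
      Submodule.span ℝ (Set.range fun i : Fin 4 => ιV (u i)) := by
    rw [range_eq_span _ u hspan]
    rfl
  have hE : Eelt e = AntiFam.E (fun i => ιW V (Pi.single i 1)) (fun i => ιV (u i)) := by
    simp [Eelt, AntiFam.E, Fin.sum_univ_three, u0, u1, u2]
  have hO02 : Omeg V 0 2 = Submodule.span ℝ (Set.range (AntiFam.V2 fun i => ιV (u i))) := by
    rw [Omeg, hRV, h.RV2, pow_zero, one_mul]
  have hO12 : Omeg V 1 2 = Submodule.span ℝ (Set.range fun x : Fin 3 × Fin 6 =>
      ιW V (Pi.single x.1 1) * AntiFam.V2 (fun i => ιV (u i)) x.2) := by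
    rw [Omeg, hRV, h.RV2, pow_one, hRW, AntiFam.span_mul_range]
  have hO13 : Omeg V 1 3 = Submodule.span ℝ (Set.range fun x : Fin 3 × Fin 4 =>
      ιW V (Pi.single x.1 1) * AntiFam.V3 (fun i => ιV (u i)) x.2) := by
    rw [Omeg, hRV, h.RV3, pow_one, hRW, AntiFam.span_mul_range]
  have f02 : FiniteDimensional ℝ ↥(Omeg V 0 2) := by
    rw [hO02]
    exact FiniteDimensional.span_of_finite ℝ (Set.finite_range _)
  have f12 : FiniteDimensional ℝ ↥(Omeg V 1 2) := by
    rw [hO12]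
    exact FiniteDimensional.span_of_finite ℝ (Set.finite_range _)
  have d02 : Module.finrank ℝ ↥(Omeg V 0 2) ≤ 6 := by
    rw [hO02]
    exact finrank_range_le_card _
  have d13 : Module.finrank ℝ ↥(Omeg V 1 3) = 12 := by
    rw [hO13, finrank_span_eq_card h.li13]
    simp
  have dK := h.finrank_ker_le
  have hs := h.surj13
  rw [← hO12, ← hE] at dK
  rw [← hO12, ← hE, ← hO13, ← hO02] at hs
  obtain ⟨r1, r2, r3, r4, r5⟩ := AntiFam.linalg (LinearMap.mulLeft ℝ (Eelt e))
    (LinearMap.mulLeft ℝ (ιV εn)) (Omeg V 0 2)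
    (Omeg V 1 2 ⊓ LinearMap.ker (LinearMap.mulLeft ℝ (Eelt e))) (Omeg V 1 3) d02 dK d13 hs
  exact ⟨r1, fun β h1 h2 h3 => r2 β ⟨h1, h2⟩ h3, r3, r4, r5⟩
end
end

section
/- (Splitting of spinor-valued (3,1)-forms in the bulk) Let e: R⁴→V be a linear isomorphism (dim V = 4), γ̲ := [e,γ] = γ_μ dx^μ the metric contraction of e with γ = γ^a v_a, and S = C⁴ the Dirac spinor space. For every θ ∈ Λ³(R⁴)*⊗V⊗S there exist unique α ∈ Λ¹(R⁴)*⊗S and β ∈ Λ³(R⁴)*⊗V⊗S with γ³β = 0 (where γ³ acts by Clifford multiplication and wedge on the Λ•V factor, landing in Λ³(R⁴)*⊗Λ⁴V⊗S) such that θ = i e∧γ̲ α + β. -/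
noncomputable section

/-- The (pointwise, complexified) total exterior algebra `Λ•((ℝ⁴)* ⊕ V)` for the bulk,
with `V ≅ ℝ⁴`; spinor-valued `(k,l)`-forms are modelled as `ℂ⁴`-indexed families of
elements of this algebra lying in the subspace `Ω^{(k,l)}`. -/
abbrev BExt4 : Type := ExteriorAlgebra ℂ ((Fin 4 → ℂ) × (Fin 4 → ℂ))

/-- The inclusion of the bulk covector `dx^μ`. -/
def ιW4 (μ : Fin 4) : BExt4 := ExteriorAlgebra.ι ℂ (Pi.single μ 1, 0)

/-- The inclusion of the basis vector `v_a` of `V`. -/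
def ιV4 (a : Fin 4) : BExt4 := ExteriorAlgebra.ι ℂ (0, Pi.single a 1)

/-- The subspace `Ω^{(k,l)} = Λ^k(ℝ⁴)* ⊗ Λ^l V` of `BExt4`. -/
def Omeg4 (k l : ℕ) : Submodule ℂ BExt4 :=
  (LinearMap.range ((ExteriorAlgebra.ι ℂ).comp
      (LinearMap.inl ℂ (Fin 4 → ℂ) (Fin 4 → ℂ)))) ^ k *
    (LinearMap.range ((ExteriorAlgebra.ι ℂ).comp
      (LinearMap.inr ℂ (Fin 4 → ℂ) (Fin 4 → ℂ)))) ^ l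

/-- The entries `e^a_μ` of the vielbein `e : ℝ⁴ → V ≅ ℝ⁴`, as complex numbers. -/
def ecoef (e : (Fin 4 → ℝ) →ₗ[ℝ] (Fin 4 → ℝ)) (a μ : Fin 4) : ℂ :=
  ((e (Pi.single μ 1)) a : ℝ)

/-- The vielbein as an element `e = e^a_μ dx^μ ⊗ v_a ∈ Ω^{(1,1)}`. -/
def Eelt4 (e : (Fin 4 → ℝ) →ₗ[ℝ] (Fin 4 → ℝ)) : BExt4 :=
  ∑ μ : Fin 4, ∑ a : Fin 4, ecoef e a μ • (ιW4 μ * ιV4 a)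

/-- `γ_μ := γ_a e^a_μ`, the components of `γ̲ = γ_μ dx^μ`. -/
def γlow (e : (Fin 4 → ℝ) →ₗ[ℝ] (Fin 4 → ℝ)) (γ : Fin 4 → Matrix (Fin 4) (Fin 4) ℂ)
    (μ : Fin 4) : Matrix (Fin 4) (Fin 4) ℂ :=
  ∑ a : Fin 4, ecoef e a μ • γ a

/-- The `σ`-th spinor component of `e ∧ γ̲ α` for a spinor-valued 1-form `α`. -/
def eGammaUnder (e : (Fin 4 → ℝ) →ₗ[ℝ] (Fin 4 → ℝ))
    (γ : Fin 4 → Matrix (Fin 4) (Fin 4) ℂ) (α : Fin 4 → BExt4) (σ : Fin 4) : BExt4 :=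
  Eelt4 e * ∑ μ : Fin 4, ∑ τ : Fin 4, (γlow e γ μ) σ τ • (ιW4 μ * α τ)

/-- The `σ`-th spinor component of `γ³ β` for a spinor-valued `(3,1)`-form `β`;
`γ³ = γ^a γ^b γ^c v_a ∧ v_b ∧ v_c` acts by Clifford multiplication on the spinor index
and by wedging on the `Λ•V` factor. -/
def gammaCubeAct (γ : Fin 4 → Matrix (Fin 4) (Fin 4) ℂ) (β : Fin 4 → BExt4)
    (σ : Fin 4) : BExt4 :=
  ∑ a : Fin 4, ∑ b : Fin 4, ∑ c : Fin 4, ∑ τ : Fin 4,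
    ((gup γ a * gup γ b * gup γ c) σ τ) • (ιV4 a * (ιV4 b * (ιV4 c * β τ)))
open Matrix

/-- Two anticommuting families of square-zero elements. -/
structure Frame {A : Type*} [Ring A] (E v : Fin 4 → A) : Prop where
  hE : ∀ a b, E a * E b = -(E b * E a)
  hE0 : ∀ a, E a * E a = 0
  hv : ∀ a b, v a * v b = -(v b * v a)
  hv0 : ∀ a, v a * v a = 0
  hm : ∀ a b, v a * E b = -(E b * v a)

/-- Ordered triple product omitting the index `d`. -/
def tri {A : Type*} [Ring A] (E : Fin 4 → A) (d : Fin 4) : A :=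
  ![E 1 * (E 2 * E 3), E 0 * (E 2 * E 3), E 0 * (E 1 * E 3), E 0 * (E 1 * E 2)] d

/-- Volume element. -/
def volu {A : Type*} [Ring A] (v : Fin 4 → A) : A := v 0 * (v 1 * (v 2 * v 3))

section fr
variable {A : Type*} [Ring A] {E v : Fin 4 → A}

theorem Frame.sE (h : Frame E v) (a b : Fin 4) (_ : b < a) : E a * E b = -(E b * E a) := h.hE a b
theorem Frame.sE' (h : Frame E v) (a b : Fin 4) (_ : b < a) (x : A) :
    E a * (E b * x) = -(E b * (E a * x)) := by
  rw [← mul_assoc, h.hE, neg_mul, mul_assoc]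
theorem Frame.sE0' (h : Frame E v) (a : Fin 4) (x : A) : E a * (E a * x) = 0 := by
  rw [← mul_assoc, h.hE0, zero_mul]
theorem Frame.sv (h : Frame E v) (a b : Fin 4) (_ : b < a) : v a * v b = -(v b * v a) := h.hv a b
theorem Frame.sv' (h : Frame E v) (a b : Fin 4) (_ : b < a) (x : A) :
    v a * (v b * x) = -(v b * (v a * x)) := by
  rw [← mul_assoc, h.hv, neg_mul, mul_assoc]
theorem Frame.sv0' (h : Frame E v) (a : Fin 4) (x : A) : v a * (v a * x) = 0 := by
  rw [← mul_assoc, h.hv0, zero_mul]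
theorem Frame.sm' (h : Frame E v) (a b : Fin 4) (x : A) :
    v a * (E b * x) = -(E b * (v a * x)) := by
  rw [← mul_assoc, h.hm, neg_mul, mul_assoc]

theorem Frame.tri_mem [Algebra ℂ A] (h : Frame E v) (a b c : Fin 4) :
    E a * (E b * E c) ∈ Submodule.span ℂ (Set.range (tri E)) := by
  have H : ∀ d, tri E d ∈ Submodule.span ℂ (Set.range (tri E)) :=
    fun d => Submodule.subset_span ⟨d, rfl⟩
  have h0 := H 0
  have h1 := H 1
  have h2 := H 2
  have h3 := H 3
  simp only [tri, Matrix.cons_val] at h0 h1 h2 h3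
  fin_cases a <;> fin_cases b <;> fin_cases c <;>
    simp [h.sE, h.sE', h.sE0', h.hE0, h0, h1, h2, h3]

/-- The independence of the triple products. -/
theorem Frame.indep [Algebra ℂ A] (h : Frame E v) (hV : volu E * volu v ≠ 0) (t : Fin 4 → ℂ)
    (ht : ∑ d, t d • (tri E d * volu v) = 0) : ∀ d, t d = 0 := by
  intro d
  have h2 := congrArg (fun x => E d * x) ht
  have key : ∀ s : ℂ, s • (volu E * volu v) = 0 → s = 0 := fun s hs =>
    (smul_eq_zero.1 hs).resolve_right hV
  apply key
  fin_cases d <;>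
    simpa [Fin.sum_univ_four, mul_add, tri, volu, mul_assoc, h.sE, h.sE', h.sE0', h.hE0] using h2

end fr

section mat
variable {g : Fin 4 → Matrix (Fin 4) (Fin 4) ℂ} {s : Fin 4 → ℂ}

theorem m_swap (hg : ∀ a b, a ≠ b → g a * g b = -(g b * g a)) (a b : Fin 4) (hab : b < a) :
    g a * g b = -(g b * g a) := hg a b hab.ne'
theorem m_swap' (hg : ∀ a b, a ≠ b → g a * g b = -(g b * g a)) (a b : Fin 4) (hab : b < a)
    (x : Matrix (Fin 4) (Fin 4) ℂ) :
    g a * (g b * x) = -(g b * (g a * x)) := by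
  rw [← mul_assoc, hg a b hab.ne', neg_mul, mul_assoc]

theorem cube_eq {A : Type*} [Ring A] [Algebra ℂ A] {E v : Fin 4 → A} (h : Frame E v)
    (hg : ∀ a b, a ≠ b → g a * g b = -(g b * g a)) (σ τ : Fin 4) (x : A) :
    ∑ a : Fin 4, ∑ b : Fin 4, ∑ c : Fin 4,
      ((g a * g b * g c) σ τ) • (v a * (v b * (v c * x))) =
    (6 * (g 1 * (g 2 * g 3)) σ τ) • (v 1 * (v 2 * (v 3 * x)))
    + (6 * (g 0 * (g 2 * g 3)) σ τ) • (v 0 * (v 2 * (v 3 * x)))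
    + (6 * (g 0 * (g 1 * g 3)) σ τ) • (v 0 * (v 1 * (v 3 * x)))
    + (6 * (g 0 * (g 1 * g 2)) σ τ) • (v 0 * (v 1 * (v 2 * x))) := by
  simp [Fin.sum_univ_four, mul_assoc, h.sv', h.sv0', m_swap hg, m_swap' hg]
  module

/-- The flat Rarita-Schwinger operator. -/
def RS (g : Fin 4 → Matrix (Fin 4) (Fin 4) ℂ) :
    (Fin 4 → Fin 4 → ℂ) →ₗ[ℂ] (Fin 4 → Fin 4 → ℂ) where
  toFun φ := ![
    g 1 *ᵥ g 2 *ᵥ φ 3 - g 1 *ᵥ g 3 *ᵥ φ 2 + g 2 *ᵥ g 3 *ᵥ φ 1,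
    g 0 *ᵥ g 2 *ᵥ φ 3 - g 0 *ᵥ g 3 *ᵥ φ 2 + g 2 *ᵥ g 3 *ᵥ φ 0,
    g 0 *ᵥ g 1 *ᵥ φ 3 - g 0 *ᵥ g 3 *ᵥ φ 1 + g 1 *ᵥ g 3 *ᵥ φ 0,
    g 0 *ᵥ g 1 *ᵥ φ 2 - g 0 *ᵥ g 2 *ᵥ φ 1 + g 1 *ᵥ g 2 *ᵥ φ 0]
  map_add' x y := by
    ext d : 1
    fin_cases d <;> simp [Matrix.mulVec_add] <;> abel
  map_smul' c x := by
    ext d : 1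
    fin_cases d <;> simp [Matrix.mulVec_smul, smul_sub]

theorem RS_aux (hg : ∀ a b, a ≠ b → g a * g b = -(g b * g a))
    (hs : ∀ a, g a * g a = s a • 1) (hs1 : ∀ a, s a * s a = 1) (φ : Fin 4 → Fin 4 → ℂ)
    (a b c : Fin 4) (hab : a ≠ b) (hac : a ≠ c) (hbc : b ≠ c)
    (H : g a *ᵥ g b *ᵥ φ c - g a *ᵥ g c *ᵥ φ b + g b *ᵥ g c *ᵥ φ a = 0) :
    s a • g a *ᵥ φ a + s b • g b *ᵥ φ b + s c • g c *ᵥ φ c = 0 := by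
  have e1 : g c * g b * g a * (g a * g b) = (s a * s b) • g c := by
    rw [show g c * g b * g a * (g a * g b) = g c * (g b * (g a * g a) * g b) by noncomm_ring, hs]
    simp [hs, smul_smul]
  have e2 : g c * g b * g a * (g a * g c) = -((s a * s c) • g b) := by
    rw [show g c * g b * g a * (g a * g c) = g c * g b * (g a * g a) * g c by noncomm_ring, hs,
      hg c b hbc.symm]
    simp [hs, smul_smul, mul_assoc]
  have e3 : g c * g b * g a * (g b * g c) = (s b * s c) • g a := by
    rw [show g c * g b * g a * (g b * g c) = g c * g b * (g a * g b) * g c by noncomm_ring,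
      hg a b hab, show g c * g b * -(g b * g a) * g c = - (g c * (g b * g b) * (g a * g c))
        by noncomm_ring, hs, hg a c hac,
      show -(g c * s b • 1 * -(g c * g a)) = s b • (g c * g c) * g a by
        simp [mul_assoc]]
    simp [hs, smul_smul]
  have H2 := congrArg (fun x => (s a * s b * s c) • (g c * g b * g a) *ᵥ x) H
  simp only [Matrix.mulVec_add, Matrix.mulVec_sub, Matrix.mulVec_mulVec, Matrix.mulVec_zero,
    e1, e2, e3, Matrix.smul_mulVec, Matrix.neg_mulVec, smul_add, smul_sub, smul_neg, smul_smul,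
    smul_zero] at H2
  rw [show s a * s b * s c * (s a * s b) = (s a * s a) * (s b * s b) * s c by ring,
    show s a * s b * s c * (s a * s c) = (s a * s a) * (s c * s c) * s b by ring,
    show s a * s b * s c * (s b * s c) = (s b * s b) * (s c * s c) * s a by ring] at H2
  simp only [hs1, one_mul, sub_neg_eq_add] at H2
  rw [← H2]; abel

theorem RS_inj (hg : ∀ a b, a ≠ b → g a * g b = -(g b * g a))
    (hs : ∀ a, g a * g a = s a • 1) (hs1 : ∀ a, s a * s a = 1) :
    Function.Injective (RS g) := by
  rw [← LinearMap.ker_eq_bot, LinearMap.ker_eq_bot']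
  intro φ hφ
  have h0 := RS_aux hg hs hs1 φ 1 2 3 (by decide) (by decide) (by decide) (congrFun hφ 0)
  have h1 := RS_aux hg hs hs1 φ 0 2 3 (by decide) (by decide) (by decide) (congrFun hφ 1)
  have h2 := RS_aux hg hs hs1 φ 0 1 3 (by decide) (by decide) (by decide) (congrFun hφ 2)
  have h3 := RS_aux hg hs hs1 φ 0 1 2 (by decide) (by decide) (by decide) (congrFun hφ 3)
  have key : ∀ a, s a • g a *ᵥ φ a = 0 := by
    intro a
    ext i
    have k0 := congrFun h0 i
    have k1 := congrFun h1 i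
    have k2 := congrFun h2 i
    have k3 := congrFun h3 i
    simp only [Pi.add_apply, Pi.zero_apply] at k0 k1 k2 k3 ⊢
    fin_cases a <;> simp only [Fin.zero_eta, Fin.mk_one, Fin.reduceFinMk]
    · linear_combination (k1 + k2 + k3 - 2 * k0) / 3
    · linear_combination (k0 + k2 + k3 - 2 * k1) / 3
    · linear_combination (k1 + k0 + k3 - 2 * k2) / 3
    · linear_combination (k1 + k2 + k0 - 2 * k3) / 3
  ext a : 1
  have := congrArg (fun x => g a *ᵥ x) (key a)
  simpa [Matrix.mulVec_smul, hs, Matrix.smul_mulVec, smul_smul, hs1] using this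
end mat

section cliff
variable {γ : Fin 4 → Matrix (Fin 4) (Fin 4) ℂ}

theorem cl_swap (hcl : ∀ a b : Fin 4,
      γ a * γ b + γ b * γ a = (-2 * mink a b) • (1 : Matrix (Fin 4) (Fin 4) ℂ))
    (a b : Fin 4) (hab : a ≠ b) : γ a * γ b = -(γ b * γ a) := by
  have := hcl a b
  simp only [mink, if_neg hab, mul_zero, zero_smul] at this
  exact eq_neg_of_add_eq_zero_left this

theorem cl_sq (hcl : ∀ a b : Fin 4,
      γ a * γ b + γ b * γ a = (-2 * mink a b) • (1 : Matrix (Fin 4) (Fin 4) ℂ))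
    (a : Fin 4) : γ a * γ a = (-mink a a) • 1 := by
  have := hcl a a
  rw [← two_smul ℂ, show -2 * mink a a = 2 * (-mink a a) by ring, mul_smul] at this
  exact smul_right_injective _ (two_ne_zero) this

theorem cl_s1 (a : Fin 4) : (-mink a a) * (-mink a a) = 1 := by
  simp only [mink]; split_ifs <;> simp

theorem gup_zero (γ : Fin 4 → Matrix (Fin 4) (Fin 4) ℂ) : gup γ 0 = - γ 0 := by
  simp [gup, mink]
theorem gup_one (γ : Fin 4 → Matrix (Fin 4) (Fin 4) ℂ) : gup γ 1 = γ 1 := by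
  simp [gup, mink]
theorem gup_two (γ : Fin 4 → Matrix (Fin 4) (Fin 4) ℂ) : gup γ 2 = γ 2 := by
  simp [gup, mink]
theorem gup_three (γ : Fin 4 → Matrix (Fin 4) (Fin 4) ℂ) : gup γ 3 = γ 3 := by
  simp [gup, mink]

theorem gup_eq (γ : Fin 4 → Matrix (Fin 4) (Fin 4) ℂ) (a : Fin 4) :
    gup γ a = mink a a • γ a := by
  simp [gup, mink]

theorem gup_swap (hcl : ∀ a b : Fin 4,
      γ a * γ b + γ b * γ a = (-2 * mink a b) • (1 : Matrix (Fin 4) (Fin 4) ℂ))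
    (a b : Fin 4) (hab : a ≠ b) : gup γ a * gup γ b = -(gup γ b * gup γ a) := by
  simp only [gup_eq, Matrix.smul_mul, Matrix.mul_smul]
  rw [cl_swap hcl a b hab, smul_neg, smul_neg, smul_comm]

/-- The chirality matrix. -/
def chir (γ : Fin 4 → Matrix (Fin 4) (Fin 4) ℂ) : Matrix (Fin 4) (Fin 4) ℂ :=
  gup γ 0 * (gup γ 1 * (gup γ 2 * gup γ 3))

theorem chir_facts (hcl : ∀ a b : Fin 4,
      γ a * γ b + γ b * γ a = (-2 * mink a b) • (1 : Matrix (Fin 4) (Fin 4) ℂ)) :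
    chir γ * γ 0 = gup γ 1 * (gup γ 2 * gup γ 3) ∧
    chir γ * γ 1 = -(gup γ 0 * (gup γ 2 * gup γ 3)) ∧
    chir γ * γ 2 = gup γ 0 * (gup γ 1 * gup γ 3) ∧
    chir γ * γ 3 = -(gup γ 0 * (gup γ 1 * gup γ 2)) ∧
    chir γ * (γ 3 * (γ 2 * (γ 1 * γ 0))) = 1 := by
  have h0 : γ 0 * γ 0 = 1 := by rw [cl_sq hcl]; simp [mink]
  have h1 : γ 1 * γ 1 = -1 := by rw [cl_sq hcl]; simp [mink]
  have h2 : γ 2 * γ 2 = -1 := by rw [cl_sq hcl]; simp [mink]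
  have h3 : γ 3 * γ 3 = -1 := by rw [cl_sq hcl]; simp [mink]
  have h0' : ∀ x, γ 0 * (γ 0 * x) = x := fun x => by rw [← mul_assoc, h0, one_mul]
  have h1' : ∀ x, γ 1 * (γ 1 * x) = -x := fun x => by rw [← mul_assoc, h1, neg_one_mul]
  have h2' : ∀ x, γ 2 * (γ 2 * x) = -x := fun x => by rw [← mul_assoc, h2, neg_one_mul]
  have h3' : ∀ x, γ 3 * (γ 3 * x) = -x := fun x => by rw [← mul_assoc, h3, neg_one_mul]
  have sw := m_swap (cl_swap hcl)
  have sw' := m_swap' (cl_swap hcl)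
  refine ⟨?_, ?_, ?_, ?_, ?_⟩ <;>
    simp [chir, gup_zero, gup_one, gup_two, gup_three, mul_assoc, h0, h1, h2, h3,
      h0', h1', h2', h3', sw, sw']

variable {A : Type*} [Ring A] [Algebra ℂ A] {E v : Fin 4 → A}

theorem cubeE (hcl : ∀ a b : Fin 4,
      γ a * γ b + γ b * γ a = (-2 * mink a b) • (1 : Matrix (Fin 4) (Fin 4) ℂ))
    (h : Frame E v) (σ τ : Fin 4) (x : A) :
    ∑ a : Fin 4, ∑ b : Fin 4, ∑ c : Fin 4,
      ((gup γ a * gup γ b * gup γ c) σ τ) • (v a * (v b * (v c * ((∑ d, E d * v d) * x)))) =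
    ∑ d, (6 * (chir γ * γ d) σ τ) • (E d * (volu v * x)) := by
  rw [cube_eq h (gup_swap hcl)]
  obtain ⟨c0, c1, c2, c3, -⟩ := chir_facts hcl
  simp only [Fin.sum_univ_four, c0, c1, c2, c3, volu]
  simp [mul_assoc, add_mul, mul_add, h.sm', h.sv', h.sv0', Matrix.neg_apply]

theorem vol_comm (h : Frame E v) (a : Fin 4) (x : A) :
    volu v * (E a * x) = E a * (volu v * x) := by
  simp [volu, mul_assoc, h.sm']

theorem vol_comm' (h : Frame E v) (a : Fin 4) :
    volu v * E a = E a * volu v := by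
  simpa using vol_comm h a 1

theorem flat_formula (hcl : ∀ a b : Fin 4,
      γ a * γ b + γ b * γ a = (-2 * mink a b) • (1 : Matrix (Fin 4) (Fin 4) ℂ))
    (h : Frame E v) (φ : Fin 4 → Fin 4 → ℂ) (σ : Fin 4) :
    ∑ a : Fin 4, ∑ b : Fin 4, ∑ c : Fin 4, ∑ τ : Fin 4,
      ((gup γ a * gup γ b * gup γ c) σ τ) • (v a * (v b * (v c * ((∑ d, E d * v d) *
        ∑ d : Fin 4, ∑ ρ : Fin 4, (γ d) τ ρ • (E d * ∑ k, φ k ρ • E k))))) =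
    ∑ d, (12 * (chir γ *ᵥ RS γ φ d) σ) • (tri E d * volu v) := by
  have s1 : ∀ τ, ∑ d : Fin 4, ∑ ρ : Fin 4, (γ d) τ ρ • (E d * ∑ k, φ k ρ • E k) =
      ∑ d : Fin 4, ∑ k : Fin 4, (γ d *ᵥ φ k) τ • (E d * E k) := by
    intro τ
    refine Finset.sum_congr rfl fun d _ => ?_
    simp only [Matrix.mulVec, dotProduct, Finset.sum_smul, Finset.mul_sum, Finset.smul_sum,
      mul_smul_comm, smul_smul]
    exact Finset.sum_comm
  have s2 : ∀ f : Fin 4 → Fin 4 → Fin 4 → Fin 4 → A,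
      ∑ a, ∑ b, ∑ c, ∑ τ, f a b c τ = ∑ τ, ∑ a, ∑ b, ∑ c, f a b c τ := by
    intro f
    have : ∀ a b, ∑ c, ∑ τ, f a b c τ = ∑ τ, ∑ c, f a b c τ := fun a b => Finset.sum_comm
    simp only [this]
    have : ∀ a, ∑ b, ∑ τ, ∑ c, f a b c τ = ∑ τ, ∑ b, ∑ c, f a b c τ := fun a => Finset.sum_comm
    simp only [this]
    exact Finset.sum_comm
  rw [s2]
  simp only [cubeE hcl h, s1]
  have s3 : ∀ d, ∑ τ, (6 * (chir γ * γ d) σ τ) • (E d * (volu v *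
      ∑ a : Fin 4, ∑ k : Fin 4, (γ a *ᵥ φ k) τ • (E a * E k))) =
      ∑ a : Fin 4, ∑ k : Fin 4, (6 * (chir γ *ᵥ γ d *ᵥ γ a *ᵥ φ k) σ) •
        (E d * (E a * (E k * volu v))) := by
    intro d
    simp only [Finset.mul_sum, mul_smul_comm, Finset.smul_sum, smul_smul, vol_comm h, vol_comm' h]
    rw [Finset.sum_comm]
    refine Finset.sum_congr rfl fun a _ => ?_
    rw [Finset.sum_comm]
    refine Finset.sum_congr rfl fun k _ => ?_
    rw [← Finset.sum_smul, Matrix.mulVec_mulVec (v := γ a *ᵥ φ k)]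
    congr 1
    rw [Matrix.mulVec, dotProduct, Finset.mul_sum]
    exact Finset.sum_congr rfl fun τ _ => by ring
  rw [Finset.sum_comm]
  simp only [s3]
  simp [Fin.sum_univ_four, mul_assoc, RS, tri, h.sE', h.sE0', m_swap (cl_swap hcl),
    Matrix.mulVec_add, Matrix.mulVec_sub, Matrix.neg_mulVec]
  module

theorem vvvv_mem (h : Frame E v) (a b c d : Fin 4) :
    ∃ r : ℂ, v a * (v b * (v c * v d)) = r • volu v := by
  have P : ∃ r : ℂ, volu v = r • volu v := ⟨1, by simp⟩
  have N : ∃ r : ℂ, -volu v = r • volu v := ⟨-1, by simp⟩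
  have Z : ∃ r : ℂ, (0 : A) = r • volu v := ⟨0, by simp⟩
  rw [volu] at *
  fin_cases a <;> fin_cases b <;> fin_cases c <;> fin_cases d <;>
    simp only [Fin.zero_eta, Fin.mk_one, Fin.reduceFinMk, Fin.isValue, h.sv, h.sv', h.sv0', h.hv0,
      Fin.reduceLT, mul_neg, neg_neg, mul_zero, neg_zero] <;>
    first | exact P | exact N | exact Z

theorem v_tri (h : Frame E v) (a d : Fin 4) (x : A) :
    v a * (tri E d * x) = -(tri E d * (v a * x)) := by
  fin_cases d <;> simp [tri, mul_assoc, h.sm']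

theorem vvv_mem (h : Frame E v) (a b c : Fin 4) (x : A)
    (hx : x ∈ Submodule.span ℂ (Set.range (tri E)) * Submodule.span ℂ (Set.range v)) :
    v a * (v b * (v c * x)) ∈ Submodule.span ℂ (Set.range fun d => tri E d * volu v) := by
  rw [Submodule.span_mul_span] at hx
  induction hx using Submodule.span_induction with
  | mem x hx =>
    obtain ⟨_, ⟨d, rfl⟩, _, ⟨k, rfl⟩, rfl⟩ := hx
    obtain ⟨r, hr⟩ := vvvv_mem h a b c k
    have : v a * (v b * (v c * (tri E d * v k))) = (-r) • (tri E d * volu v) := by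
      simp only [v_tri h, mul_neg, neg_neg, hr]
      simp
    simp only [this]
    exact Submodule.smul_mem _ _ (Submodule.subset_span ⟨d, rfl⟩)
  | zero => simp
  | add x y _ _ hx hy => simpa only [mul_add] using Submodule.add_mem _ hx hy
  | smul r x _ hx => simpa only [mul_smul_comm] using Submodule.smul_mem _ r hx

theorem cubeW (h : Frame E v) :
    (Submodule.span ℂ (Set.range E)) ^ 3 ≤ Submodule.span ℂ (Set.range (tri E)) := by
  rw [pow_succ, pow_two, Submodule.span_mul_span, Submodule.span_mul_span, Submodule.span_le]
  rintro _ ⟨_, ⟨_, ⟨a, rfl⟩, _, ⟨b, rfl⟩, rfl⟩, _, ⟨c, rfl⟩, rfl⟩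
  simp only [mul_assoc]
  exact h.tri_mem a b c

end cliff

section bulk

/-- The coframe element `e^a = e^a_μ dx^μ`. -/
def cofr (e : (Fin 4 → ℝ) →ₗ[ℝ] (Fin 4 → ℝ)) (a : Fin 4) : BExt4 :=
  ExteriorAlgebra.ι ℂ ((fun μ => ecoef e a μ), 0)

theorem ι_swap (x y : (Fin 4 → ℂ) × (Fin 4 → ℂ)) :
    ExteriorAlgebra.ι ℂ x * ExteriorAlgebra.ι ℂ y
      = -(ExteriorAlgebra.ι ℂ y * ExteriorAlgebra.ι ℂ x) :=
  eq_neg_of_add_eq_zero_left (ExteriorAlgebra.ι_add_mul_swap x y)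

theorem cofr_frame (e : (Fin 4 → ℝ) →ₗ[ℝ] (Fin 4 → ℝ)) : Frame (cofr e) ιV4 where
  hE _ _ := ι_swap _ _
  hE0 _ := ExteriorAlgebra.ι_sq_zero _
  hv _ _ := ι_swap _ _
  hv0 _ := ExteriorAlgebra.ι_sq_zero _
  hm _ _ := ι_swap _ _

theorem ι_inl (x : Fin 4 → ℂ) :
    (ExteriorAlgebra.ι ℂ (x, (0 : Fin 4 → ℂ)) : BExt4) = ∑ μ, x μ • ιW4 μ := by
  have h1 : (x, (0 : Fin 4 → ℂ)) = ∑ μ, x μ • ((Pi.single μ 1 : Fin 4 → ℂ), (0 : Fin 4 → ℂ)) := by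
    rw [Prod.ext_iff, Prod.fst_sum, Prod.snd_sum]
    constructor
    · ext i; simp [Pi.single_apply]
    · simp
  rw [h1, map_sum]
  simp only [map_smul, ιW4]

theorem ι_inr (x : Fin 4 → ℂ) :
    (ExteriorAlgebra.ι ℂ ((0 : Fin 4 → ℂ), x) : BExt4) = ∑ μ, x μ • ιV4 μ := by
  have h1 : ((0 : Fin 4 → ℂ), x) = ∑ μ, x μ • ((0 : Fin 4 → ℂ), (Pi.single μ 1 : Fin 4 → ℂ)) := by
    rw [Prod.ext_iff, Prod.fst_sum, Prod.snd_sum]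
    constructor
    · simp
    · ext i; simp [Pi.single_apply]
  rw [h1, map_sum]
  simp only [map_smul, ιV4]

theorem cofr_eq (e : (Fin 4 → ℝ) →ₗ[ℝ] (Fin 4 → ℝ)) (a : Fin 4) :
    cofr e a = ∑ μ, ecoef e a μ • ιW4 μ := ι_inl _

theorem ecoef_inv (e : (Fin 4 → ℝ) →ₗ[ℝ] (Fin 4 → ℝ)) (he : Function.Bijective e) :
    ∃ F : Matrix (Fin 4) (Fin 4) ℂ, F * Matrix.of (ecoef e) = 1 ∧ Matrix.of (ecoef e) * F = 1 := by
  let e' := LinearEquiv.ofBijective e he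
  have h : LinearMap.toMatrix' (e'.symm : (Fin 4 → ℝ) →ₗ[ℝ] (Fin 4 → ℝ)) * LinearMap.toMatrix' e
      = 1 := by
    rw [← LinearMap.toMatrix'_comp, ← LinearMap.toMatrix'_id]
    congr 1
    exact LinearMap.ext fun x => e'.symm_apply_apply x
  have hE : Matrix.of (ecoef e) = (LinearMap.toMatrix' e).map (algebraMap ℝ ℂ) := by
    ext i j
    simp [ecoef, LinearMap.toMatrix'_apply]
  have h2 : (LinearMap.toMatrix' (e'.symm : (Fin 4 → ℝ) →ₗ[ℝ] (Fin 4 → ℝ))).map (algebraMap ℝ ℂ)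
      * Matrix.of (ecoef e) = 1 := by
    rw [hE, ← Matrix.map_mul, h]
    simp
  exact ⟨_, h2, mul_eq_one_comm.1 h2⟩

theorem span_W (e : (Fin 4 → ℝ) →ₗ[ℝ] (Fin 4 → ℝ)) (he : Function.Bijective e) :
    LinearMap.range ((ExteriorAlgebra.ι ℂ).comp
      (LinearMap.inl ℂ (Fin 4 → ℂ) (Fin 4 → ℂ))) = Submodule.span ℂ (Set.range (cofr e)) := by
  apply le_antisymm
  · obtain ⟨F, hF, -⟩ := ecoef_inv e he
    rintro _ ⟨x, rfl⟩
    have : (ExteriorAlgebra.ι ℂ (x, (0 : Fin 4 → ℂ)) : BExt4) =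
        ∑ a, (x ᵥ* F) a • cofr e a := by
      simp only [cofr, ← map_smul, ← map_sum]
      congr 1
      rw [Prod.ext_iff, Prod.fst_sum, Prod.snd_sum]
      constructor
      · have : (x ᵥ* F) ᵥ* Matrix.of (ecoef e) = x := by
          rw [Matrix.vecMul_vecMul, hF, Matrix.vecMul_one]
        generalize x ᵥ* F = y at this
        subst this
        ext i
        simp [Matrix.vecMul, dotProduct]
      · simp
    simp only [LinearMap.comp_apply, LinearMap.inl_apply, this]
    exact Submodule.sum_mem _ fun a _ => Submodule.smul_mem _ _ (Submodule.subset_span ⟨a, rfl⟩)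
  · rw [Submodule.span_le]
    rintro _ ⟨a, rfl⟩
    exact ⟨_, rfl⟩

theorem span_V :
    LinearMap.range ((ExteriorAlgebra.ι ℂ).comp
      (LinearMap.inr ℂ (Fin 4 → ℂ) (Fin 4 → ℂ))) = Submodule.span ℂ (Set.range ιV4) := by
  apply le_antisymm
  · rintro _ ⟨x, rfl⟩
    simp only [LinearMap.comp_apply, LinearMap.inr_apply, ι_inr]
    exact Submodule.sum_mem _ fun a _ => Submodule.smul_mem _ _ (Submodule.subset_span ⟨a, rfl⟩)
  · rw [Submodule.span_le]
    rintro _ ⟨a, rfl⟩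
    exact ⟨_, rfl⟩

/-- The eight standard generators. -/
def gens (i : Fin 8) : (Fin 4 → ℂ) × (Fin 4 → ℂ) :=
  Fin.append (fun μ : Fin 4 => ((Pi.single μ 1 : Fin 4 → ℂ), (0 : Fin 4 → ℂ)))
    (fun μ : Fin 4 => ((0 : Fin 4 → ℂ), (Pi.single μ 1 : Fin 4 → ℂ))) i

/-- Concatenation of coordinates. -/
def flat8 : ((Fin 4 → ℂ) × (Fin 4 → ℂ)) →ₗ[ℂ] (Fin 8 → ℂ) where
  toFun p := Fin.append (m := 4) (n := 4) p.1 p.2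
  map_add' p q := by
    ext i
    refine Fin.addCases (m := 4) (n := 4) (fun j => ?_) (fun j => ?_) i <;> 
      simp only [Pi.add_apply, Fin.append_left, Fin.append_right, Prod.fst_add, Prod.snd_add]
  map_smul' c q := by
    ext i
    refine Fin.addCases (m := 4) (n := 4) (fun j => ?_) (fun j => ?_) i <;> 
      simp only [Pi.smul_apply, Fin.append_left, Fin.append_right, Prod.smul_fst, Prod.smul_snd,
        RingHom.id_apply]

theorem flat_gens : (fun i => flat8 (gens i)) = (1 : Matrix (Fin 8) (Fin 8) ℂ) := by
  ext i j
  refine Fin.addCases (m := 4) (n := 4) (fun i => ?_) (fun i => ?_) i <;>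
  refine Fin.addCases (m := 4) (n := 4) (fun j => ?_) (fun j => ?_) j <;>
  simp only [flat8, gens, LinearMap.coe_mk, AddHom.coe_mk, Fin.append_left, Fin.append_right,
    Matrix.one_apply, Pi.single_apply, Pi.zero_apply, Fin.ext_iff, Fin.val_castAdd,
    Fin.val_natAdd] <;>
  split_ifs <;> first | rfl | omega

theorem det8_one : ∀ M : Matrix (Fin 8) (Fin 8) ℂ, M = 1 →
    Matrix.detRowAlternating M = (1 : ℂ) := by
  intro M hM
  have h := Matrix.det_one (n := Fin 8) (R := ℂ)
  rw [← hM] at h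
  exact h

theorem volW_ne : volu ιW4 * volu ιV4 ≠ 0 := by
  intro h0
  let D : ((Fin 4 → ℂ) × (Fin 4 → ℂ)) [⋀^Fin 8]→ₗ[ℂ] ℂ :=
    (Matrix.detRowAlternating (R := ℂ) (n := Fin 8)).compLinearMap flat8
  let f : ∀ i : ℕ, ((Fin 4 → ℂ) × (Fin 4 → ℂ)) [⋀^Fin i]→ₗ[ℂ] ℂ :=
    Function.update 0 8 D
  have h1 : ExteriorAlgebra.liftAlternating f (ExteriorAlgebra.ιMulti ℂ 8 gens) = 1 := by
    rw [ExteriorAlgebra.liftAlternating_apply_ιMulti]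
    have h8 : f 8 = D := Function.update_self _ _ _
    rw [h8, AlternatingMap.compLinearMap_apply]
    exact det8_one _ flat_gens
  have h2 : ExteriorAlgebra.ιMulti ℂ 8 gens = volu ιW4 * volu ιV4 := by
    rw [ExteriorAlgebra.ιMulti_apply]
    simp only [List.ofFn_succ, List.ofFn_zero, List.prod_cons, List.prod_nil, mul_one, volu,
      mul_assoc]
    rfl
  rw [h2, h0, map_zero] at h1
  exact zero_ne_one h1

theorem volE_ne (e : (Fin 4 → ℝ) →ₗ[ℝ] (Fin 4 → ℝ)) (he : Function.Bijective e) :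
    volu (cofr e) * volu ιV4 ≠ 0 := by
  intro h0
  obtain ⟨F, -, hF⟩ := ecoef_inv e he
  let T : ((Fin 4 → ℂ) × (Fin 4 → ℂ)) →ₗ[ℂ] ((Fin 4 → ℂ) × (Fin 4 → ℂ)) :=
    (Matrix.vecMulLinear F).prodMap LinearMap.id
  have hT : ∀ a, ExteriorAlgebra.map T (cofr e a) = ιW4 a := by
    intro a
    rw [cofr, ExteriorAlgebra.map_apply_ι, ιW4]
    congr 1
    refine Prod.ext ?_ rfl
    have : (Matrix.of (ecoef e) * F) a = Pi.single a 1 := by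
      rw [hF]; ext j; simp [Matrix.one_apply, Pi.single_apply, eq_comm]
    rw [← this]
    ext j
    simp [T, Matrix.vecMul, Matrix.mul_apply, dotProduct]
  have hV : ∀ a, ExteriorAlgebra.map T (ιV4 a) = ιV4 a := by
    intro a
    rw [ιV4, ExteriorAlgebra.map_apply_ι]
    congr 1
    refine Prod.ext ?_ rfl
    simp [T]
  have := congrArg (ExteriorAlgebra.map T) h0
  simp only [volu, map_mul, hT, hV, map_zero] at this
  exact volW_ne (by simpa only [volu] using this)

theorem Eelt_eq (e : (Fin 4 → ℝ) →ₗ[ℝ] (Fin 4 → ℝ)) :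
    Eelt4 e = ∑ a, cofr e a * ιV4 a := by
  simp only [Eelt4, cofr_eq, Finset.sum_mul, smul_mul_assoc]
  exact Finset.sum_comm

theorem eGamma_eq (e : (Fin 4 → ℝ) →ₗ[ℝ] (Fin 4 → ℝ)) (γ : Fin 4 → Matrix (Fin 4) (Fin 4) ℂ)
    (α : Fin 4 → BExt4) (σ : Fin 4) :
    eGammaUnder e γ α σ = (∑ d, cofr e d * ιV4 d) *
        ∑ d : Fin 4, ∑ ρ : Fin 4, (γ d) σ ρ • (cofr e d * α ρ) := by
  rw [eGammaUnder, Eelt_eq]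
  congr 1
  simp only [γlow, cofr_eq, Matrix.sum_apply, Matrix.smul_apply, Finset.sum_smul, Finset.sum_mul,
    Finset.smul_sum, smul_mul_assoc, smul_smul, smul_eq_mul]
  rw [Finset.sum_comm, Finset.sum_comm' (t' := Finset.univ) (s' := fun _ => Finset.univ) (by simp)]
  conv_rhs => rw [Finset.sum_comm]
  rw [Finset.sum_comm]
  refine Finset.sum_congr rfl fun ρ _ => ?_
  rw [Finset.sum_comm]
  refine Finset.sum_congr rfl fun a _ => ?_
  refine Finset.sum_congr rfl fun μ _ => ?_
  rw [mul_comm]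

theorem cube_lin (γ : Fin 4 → Matrix (Fin 4) (Fin 4) ℂ) (X Y Z : Fin 4 → BExt4) (c : ℂ)
    (h : ∀ σ, Z σ = c • X σ + Y σ) (σ : Fin 4) :
    gammaCubeAct γ Z σ = c • gammaCubeAct γ X σ + gammaCubeAct γ Y σ := by
  simp only [gammaCubeAct, h, mul_add, mul_smul_comm, smul_add, Finset.sum_add_distrib,
    Finset.smul_sum]
  rw [add_left_inj]
  refine Finset.sum_congr rfl fun i _ => Finset.sum_congr rfl fun j _ =>
    Finset.sum_congr rfl fun k _ => Finset.sum_congr rfl fun l _ => ?_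
  exact smul_comm _ _ _

theorem eGamma_mem (e : (Fin 4 → ℝ) →ₗ[ℝ] (Fin 4 → ℝ)) (he : Function.Bijective e)
    (γ : Fin 4 → Matrix (Fin 4) (Fin 4) ℂ)
    (φ : Fin 4 → Fin 4 → ℂ) (σ : Fin 4) :
    eGammaUnder e γ (fun τ => ∑ k, φ k τ • cofr e k) σ ∈ Omeg4 3 1 := by
  rw [eGamma_eq, Omeg4, span_W e he, span_V, pow_one]
  have hf := cofr_frame e
  simp only [Finset.sum_mul, Finset.mul_sum, mul_smul_comm, Finset.smul_sum]
  refine Submodule.sum_mem _ fun d _ => Submodule.sum_mem _ fun a _ =>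
    Submodule.sum_mem _ fun k _ => Submodule.sum_mem _ fun l _ => Submodule.smul_mem _ _
      (Submodule.smul_mem _ _ ?_)
  have hc : ∀ a, cofr e a ∈ Submodule.span ℂ (Set.range (cofr e)) :=
    fun a => Submodule.subset_span ⟨a, rfl⟩
  have hv : ∀ a, ιV4 a ∈ Submodule.span ℂ (Set.range ιV4) :=
    fun a => Submodule.subset_span ⟨a, rfl⟩
  have key : ∀ a b c d, cofr e a * ιV4 b * (cofr e c * cofr e d) =
      cofr e a * cofr e c * cofr e d * ιV4 b := by
    intro a b c d
    simp only [mul_assoc, hf.sm', hf.hm, mul_neg, neg_neg]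
  rw [key, pow_succ, pow_two]
  exact Submodule.mul_mem_mul (Submodule.mul_mem_mul (Submodule.mul_mem_mul (hc _) (hc _)) (hc _))
    (hv _)

end bulk
/-- **splitting of spinor-valued (3,1)-forms in the bulk.** Let
`e : ℝ⁴ → V` be a linear isomorphism (`dim V = 4`), `γ̲ := γ_μ dx^μ` the metric
contraction of `e` with `γ = γ^a v_a`, and `S = ℂ⁴` the Dirac spinor space.  For every
`θ ∈ Λ³(ℝ⁴)* ⊗ V ⊗ S` there exist unique `α ∈ Λ¹(ℝ⁴)* ⊗ S` and `β ∈ Λ³(ℝ⁴)* ⊗ V ⊗ S`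
with `γ³ β = 0` such that `θ = i e ∧ γ̲ α + β`. -/
theorem splitting_spinor_three_one_forms
    (γ : Fin 4 → Matrix (Fin 4) (Fin 4) ℂ)
    (hcl : ∀ a b : Fin 4,
      γ a * γ b + γ b * γ a = (-2 * mink a b) • (1 : Matrix (Fin 4) (Fin 4) ℂ))
    (e : (Fin 4 → ℝ) →ₗ[ℝ] (Fin 4 → ℝ)) (he : Function.Bijective e) :
    ∀ θ : Fin 4 → BExt4, (∀ σ : Fin 4, θ σ ∈ Omeg4 3 1) →
      ∃! p : (Fin 4 → BExt4) × (Fin 4 → BExt4),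
        (∀ σ : Fin 4, p.1 σ ∈ Omeg4 1 0)
        ∧ (∀ σ : Fin 4, p.2 σ ∈ Omeg4 3 1)
        ∧ (∀ σ : Fin 4, gammaCubeAct γ p.2 σ = 0)
        ∧ (∀ σ : Fin 4, θ σ = Complex.I • eGammaUnder e γ p.1 σ + p.2 σ) := by
  intro θ hθ
  have hf := cofr_frame e
  have hg := cl_swap hcl
  have hinj : Function.Injective (RS γ) := RS_inj hg (cl_sq hcl) cl_s1
  have hsurj : Function.Surjective (RS γ) := LinearMap.injective_iff_surjective.1 hinj
  obtain ⟨-, -, -, -, hχ⟩ := chir_facts hcl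
  have hχ' := mul_eq_one_comm.1 hχ
  generalize hC : γ 3 * (γ 2 * (γ 1 * γ 0)) = C at hχ hχ'
  have hform : ∀ φ σ, gammaCubeAct γ (eGammaUnder e γ (fun τ => ∑ k, φ k τ • cofr e k)) σ =
      ∑ d, (12 * (chir γ *ᵥ RS γ φ d) σ) • (tri (cofr e) d * volu ιV4) := by
    intro φ σ
    simp only [gammaCubeAct, eGamma_eq]
    exact flat_formula hcl hf φ σ
  have h10 : Omeg4 1 0 = Submodule.span ℂ (Set.range (cofr e)) := by
    rw [Omeg4, span_W e he, pow_one, pow_zero, mul_one]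
  have hα : ∀ α : Fin 4 → BExt4, (∀ σ, α σ ∈ Omeg4 1 0) →
      ∃ φ : Fin 4 → Fin 4 → ℂ, α = fun τ => ∑ k, φ k τ • cofr e k := by
    intro α h
    have : ∀ τ, ∃ c : Fin 4 → ℂ, ∑ k, c k • cofr e k = α τ := fun τ => by
      have := h τ
      rw [h10] at this
      exact (Submodule.mem_span_range_iff_exists_fun ℂ).1 this
    choose c hc using this
    exact ⟨fun k τ => c τ k, funext fun τ => (hc τ).symm⟩
  -- the cube of θ
  have hθ3 : ∀ σ, ∃ c : Fin 4 → ℂ,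
      ∑ d, c d • (tri (cofr e) d * volu ιV4) = gammaCubeAct γ θ σ := by
    intro σ
    refine (Submodule.mem_span_range_iff_exists_fun ℂ).1 ?_
    refine Submodule.sum_mem _ fun a _ => Submodule.sum_mem _ fun b _ =>
      Submodule.sum_mem _ fun c _ => Submodule.sum_mem _ fun τ _ => Submodule.smul_mem _ _ ?_
    apply vvv_mem hf
    have := hθ τ
    rw [Omeg4, span_W e he, span_V, pow_one] at this
    exact mul_le_mul' (cubeW hf) le_rfl this
  choose c hc using hθ3
  have hI : (12 * Complex.I) ≠ 0 := mul_ne_zero (by norm_num) Complex.I_ne_zero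
  obtain ⟨φ, hφ⟩ := hsurj (fun d => C *ᵥ fun σ => (12 * Complex.I)⁻¹ * c σ d)
  have hφ2 : ∀ d σ, (chir γ *ᵥ RS γ φ d) σ = (12 * Complex.I)⁻¹ * c σ d := by
    intro d σ
    rw [hφ, Matrix.mulVec_mulVec, hχ, Matrix.one_mulVec]
  refine ⟨(fun τ => ∑ k, φ k τ • cofr e k,
    fun σ => θ σ - Complex.I • eGammaUnder e γ (fun τ => ∑ k, φ k τ • cofr e k) σ),
    ⟨?_, ?_, ?_, ?_⟩, ?_⟩
  · intro σ
    rw [h10]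
    change ∑ k, φ k σ • cofr e k ∈ _
    exact Submodule.sum_mem _ fun a _ => Submodule.smul_mem _ _ (Submodule.subset_span (Set.mem_range_self a))
  · intro σ
    exact Submodule.sub_mem _ (hθ σ) (Submodule.smul_mem _ _ (eGamma_mem e he γ φ σ))
  · intro σ
    have h1 := cube_lin γ (eGammaUnder e γ (fun τ => ∑ k, φ k τ • cofr e k)) θ
      (fun σ => θ σ - Complex.I • eGammaUnder e γ (fun τ => ∑ k, φ k τ • cofr e k) σ)
      (-Complex.I) (fun σ => by module) σ
    simp only at h1 ⊢
    rw [h1, hform, ← hc σ, Finset.smul_sum, ← Finset.sum_add_distrib]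
    refine Finset.sum_eq_zero fun d _ => ?_
    rw [hφ2, smul_smul, ← add_smul]
    have : -Complex.I * (12 * ((12 * Complex.I)⁻¹ * c σ d)) + c σ d = 0 := by
      field_simp
      ring
    rw [this, zero_smul]
  · intro σ
    simp
  · rintro ⟨α, β⟩ ⟨h1, h2, h3, h4⟩
    simp only at h1 h2 h3 h4
    obtain ⟨ψ, rfl⟩ := hα α h1
    have hψ : ψ = φ := by
      apply hinj
      have hz : ∀ σ d, c σ d - 12 * Complex.I * (chir γ *ᵥ RS γ ψ d) σ = 0 := by
        intro σ
        apply hf.indep (volE_ne e he)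
        have h5 := cube_lin γ _ _ _ _ h4 σ
        rw [h3, hform, ← hc σ, add_zero, Finset.smul_sum] at h5
        simp only [sub_smul, Finset.sum_sub_distrib, h5]
        rw [sub_eq_zero]
        refine Finset.sum_congr rfl fun d _ => ?_
        rw [smul_smul]
        congr 1
        ring
      ext1 d
      have hd : chir γ *ᵥ RS γ ψ d = chir γ *ᵥ RS γ φ d := by
        ext σ
        rw [hφ2, eq_inv_mul_iff_mul_eq₀ hI]
        exact (sub_eq_zero.1 (hz σ d)).symm
      have := congrArg (fun x => C *ᵥ x) hd
      simpa [Matrix.mulVec_mulVec, hχ'] using this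
    subst hψ
    refine Prod.ext rfl ?_
    funext σ
    simp only
    rw [h4 σ, add_sub_cancel_left]
end
end
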